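/- Let K ⊂ X ⊂ ℂ^m be compact sets such that K is polynomially convex and X \ K is a totally real C^∞ submanifold of real dimension d < m. Then for any k ∈ ℕ and any neighborhood U of the identity map of ℂ^m in the C^k-topology, there is a C^∞ diffeomorphism ψ : ℂ^m → ℂ^m such that (i) ψ ∈ U and ψ restricted to K is the identity, (ii) for each z ∈ X the differential Dψ_z : ℂ^m → ℂ^m is ℂ-linear, and (iii) ψ(X) is polynomially convex. -/

import Mathlib

set_option synthInstance.maxHeartbeats 4000000
set_option maxHeartbeats 4000000
open scoped Manifold Bundle
open Module Set Topology

noncomputable section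

/-- ℂᵐ as a Hermitian space. -/
abbrev CE (m : ℕ) := EuclideanSpace ℂ (Fin m)
abbrev Rn (n : ℕ) := EuclideanSpace ℝ (Fin n)

/-- A compact set `K ⊆ ℂᵐ` is polynomially convex if every point outside of it is
separated from it by the modulus of a holomorphic polynomial. -/
def IsPolyConvex {m : ℕ} (K : Set (CE m)) : Prop :=
  ∀ z ∉ K, ∃ p : MvPolynomial (Fin m) ℂ,
    ∀ w ∈ K, ‖MvPolynomial.eval (fun i => w i) p‖ < ‖MvPolynomial.eval (fun i => z i) p‖

/-- A real subspace of ℂᵐ is totally real if it contains no complex subspace of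
positive dimension. -/
def IsTotallyRealSub {m : ℕ} (P : Submodule ℝ (CE m)) : Prop :=
  ∀ L : Submodule ℂ (CE m), (L : Set (CE m)) ⊆ (P : Set (CE m)) → L = ⊥

/-- A subset of ℂᵐ is totally real if all its tangent spaces (spans of tangent cones)
are totally real subspaces. -/
def IsTotallyRealSet {m : ℕ} (A : Set (CE m)) : Prop :=
  ∀ z ∈ A, IsTotallyRealSub (Submodule.span ℝ (tangentConeAt ℝ A z))

/-- A subset `S` of a manifold `N` modelled on `I` is a smooth submanifold of
codimension `c`: locally it is a regular level set of a smooth submersion to `ℝ^c`. -/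
def MSubmanifoldCodim {E H : Type*} [NormedAddCommGroup E] [NormedSpace ℝ E]
    [TopologicalSpace H] (I : ModelWithCorners ℝ E H) {N : Type*} [TopologicalSpace N]
    [ChartedSpace H N] (S : Set N) (c : ℕ) : Prop :=
  ∀ x ∈ S, ∃ (U : Set N) (g : N → Rn c), IsOpen U ∧ x ∈ U ∧
    ContMDiffOn I (𝓡 c) (⊤ : ℕ∞) g U ∧
    (∀ y ∈ U, Function.Surjective (mfderiv I (𝓡 c) g y)) ∧
    S ∩ U = {y ∈ U | g y = 0}

/-- The image of `T_x M` in ℂᵐ under the differential of `f`; for an immersion this is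
the tangent space `T_{f(x)} f(M)`. -/
def tanImg (n : ℕ) {m : ℕ} {M : Type*} [TopologicalSpace M] [ChartedSpace (Rn n) M]
    (f : M → CE m) (x : M) : Submodule ℝ (CE m) :=
  LinearMap.range (mfderiv (𝓡 n) 𝓘(ℝ, CE m) f x).toLinearMap

/-- The set of CR-singular points of `f` : points where the tangent space of the image
is not totally real. -/
def CRsing (n : ℕ) {m : ℕ} {M : Type*} [TopologicalSpace M] [ChartedSpace (Rn n) M]
    (f : M → CE m) : Set M :=
  {x | ¬ IsTotallyRealSub (tanImg n f x)}

/-- A smooth embedding: a smooth injective immersion which is a topological embedding. -/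
def IsSmoothEmb (n : ℕ) {m : ℕ} {M : Type*} [TopologicalSpace M] [ChartedSpace (Rn n) M]
    (f : M → CE m) : Prop :=
  ContMDiff (𝓡 n) 𝓘(ℝ, CE m) (⊤ : ℕ∞) f ∧ Topology.IsEmbedding f ∧
    ∀ x : M, Function.Injective (mfderiv (𝓡 n) 𝓘(ℝ, CE m) f x)

/-- A subset `S` of a real normed space `F` is a smooth submanifold of dimension `d`:
locally it is a regular level set of a smooth submersion with values in `ℝ^c`,
where `c = finrank F - d` is the codimension. -/
def IsSubmanifoldOfDim {F : Type*} [NormedAddCommGroup F] [NormedSpace ℝ F]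
    (S : Set F) (d : ℕ) : Prop :=
  ∀ x ∈ S, ∃ (U : Set F) (c : ℕ) (g : F → Rn c), IsOpen U ∧ x ∈ U ∧
    ContDiffOn ℝ (⊤ : ℕ∞) g U ∧ (∀ y ∈ U, Function.Surjective (fderiv ℝ g y)) ∧
    S ∩ U = {y ∈ U | g y = 0} ∧ finrank ℝ F = d + c

section PolynomialLimits

variable {m : ℕ}

/-- Evaluation of a polynomial at a point of `ℂᵐ`. -/
def pev (p : MvPolynomial (Fin m) ℂ) (z : CE m) : ℂ := MvPolynomial.eval (fun i => z i) p

theorem continuous_pev (p : MvPolynomial (Fin m) ℂ) : Continuous (pev p) := by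
  unfold pev
  exact p.continuous_eval.comp (by fun_prop)

/-- The uniform closure of the polynomials on the closed ball of radius `R`. -/
def polyAlg (m : ℕ) (R : ℝ) : Subalgebra ℂ C(Metric.closedBall (0 : CE m) R, ℂ) :=
  (MvPolynomial.aeval (R := ℂ) (S₁ := C(Metric.closedBall (0 : CE m) R, ℂ))
    (fun i : Fin m => (⟨fun z => z.1 i, by fun_prop⟩ :
      C(Metric.closedBall (0 : CE m) R, ℂ)))).range.topologicalClosure

theorem isClosed_polyAlg (R : ℝ) :
    IsClosed (polyAlg m R : Set C(Metric.closedBall (0 : CE m) R, ℂ)) :=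
  Subalgebra.isClosed_topologicalClosure _

/-- Continuous functions on `ℂᵐ` that are uniform limits of polynomials on all balls. -/
def PolyLim (f : CE m → ℂ) : Prop :=
  ∃ hf : Continuous f, ∀ R : ℝ,
    (⟨fun z => f z.1, by fun_prop⟩ : C(Metric.closedBall (0 : CE m) R, ℂ)) ∈ polyAlg m R

theorem aeval_restrict_apply (R : ℝ) (p : MvPolynomial (Fin m) ℂ)
    (z : Metric.closedBall (0 : CE m) R) :
    (MvPolynomial.aeval (R := ℂ) (S₁ := C(Metric.closedBall (0 : CE m) R, ℂ))
      (fun i : Fin m => (⟨fun z => z.1 i, by fun_prop⟩ :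
        C(Metric.closedBall (0 : CE m) R, ℂ))) p) z = pev p z.1 := by
  have h := MvPolynomial.map_aeval (R := ℂ) (fun i : Fin m => (⟨fun z => z.1 i, by fun_prop⟩ :
        C(Metric.closedBall (0 : CE m) R, ℂ)))
    (ContinuousMap.evalAlgHom ℂ ℂ z : C(Metric.closedBall (0 : CE m) R, ℂ) →ₐ[ℂ] ℂ).toRingHom p
  refine h.trans ?_
  unfold pev
  rw [MvPolynomial.coe_eval₂Hom, MvPolynomial.eval, MvPolynomial.coe_eval₂Hom]
  congr 1

theorem PolyLim.pev (p : MvPolynomial (Fin m) ℂ) : PolyLim (pev p) := by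
  refine ⟨continuous_pev p, fun R => ?_⟩
  apply Subalgebra.le_topologicalClosure
  refine ⟨p, ?_⟩
  ext z
  exact aeval_restrict_apply R p z

theorem PolyLim.const (c : ℂ) : PolyLim (fun _ : CE m => c) := by
  have h := PolyLim.pev (m := m) (MvPolynomial.C c)
  have h2 : _root_.pev (m := m) (MvPolynomial.C c) = fun _ => c := by ext z; simp [_root_.pev]
  rwa [h2] at h

theorem PolyLim.add {f g : CE m → ℂ} (hf : PolyLim f) (hg : PolyLim g) :
    PolyLim (fun z => f z + g z) := by
  obtain ⟨cf, hf⟩ := hf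
  obtain ⟨cg, hg⟩ := hg
  exact ⟨cf.add cg, fun R => add_mem (hf R) (hg R)⟩

theorem PolyLim.mul {f g : CE m → ℂ} (hf : PolyLim f) (hg : PolyLim g) :
    PolyLim (fun z => f z * g z) := by
  obtain ⟨cf, hf⟩ := hf
  obtain ⟨cg, hg⟩ := hg
  exact ⟨cf.mul cg, fun R => mul_mem (hf R) (hg R)⟩

theorem PolyLim.pow {f : CE m → ℂ} (hf : PolyLim f) (n : ℕ) : PolyLim (fun z => f z ^ n) := by
  induction n with
  | zero => simpa using PolyLim.const (m := m) 1
  | succ n ih => simpa [pow_succ] using ih.mul hf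

theorem PolyLim.sum {ι : Type*} (s : Finset ι) {f : ι → CE m → ℂ} (hf : ∀ i ∈ s, PolyLim (f i)) :
    PolyLim (fun z => ∑ i ∈ s, f i z) := by
  classical
  induction s using Finset.induction_on with
  | empty => simpa using PolyLim.const (m := m) 0
  | insert a s ha ih =>
    simp only [Finset.sum_insert ha]
    exact (hf a (by simp)).add (ih fun i hi => hf i (by simp [hi]))

theorem PolyLim.clm (l : CE m →L[ℂ] ℂ) : PolyLim (fun z => l z) := by
  have h : (fun z : CE m => l z) = fun z => ∑ i, l (EuclideanSpace.single i 1) * z i := by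
    ext z
    conv_lhs => rw [← (EuclideanSpace.basisFun (Fin m) ℂ).sum_repr z]
    simp [mul_comm]
  rw [h]
  refine PolyLim.sum _ fun i _ => (PolyLim.const _).mul ?_
  have h := PolyLim.pev (m := m) (MvPolynomial.X i)
  have h2 : _root_.pev (m := m) (MvPolynomial.X i) = fun z => z i := by ext z; simp [_root_.pev]
  rwa [h2] at h

theorem PolyLim.exp {f : CE m → ℂ} (hf : PolyLim f) : PolyLim (fun z => Complex.exp (f z)) := by
  obtain ⟨cf, hf⟩ := hf
  refine ⟨by fun_prop, fun R => ?_⟩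
  have h := NormedSpace.exp_mem (R := ℂ) (isClosed_polyAlg R) (hf R)
  convert h using 1
  ext z
  have h2 := NormedSpace.map_exp
    (ContinuousMap.evalAlgHom ℂ ℂ z : C(Metric.closedBall (0 : CE m) R, ℂ) →ₐ[ℂ] ℂ)
    (ContinuousEvalConst.continuous_eval_const z) ⟨fun z => f z.1, by fun_prop⟩
  refine Eq.trans ?_ h2.symm
  exact congrFun Complex.exp_eq_exp_ℂ (f z.1)

theorem PolyLim.approx {f : CE m → ℂ} (hf : PolyLim f) (R ε : ℝ) (hε : 0 < ε) :
    ∃ p : MvPolynomial (Fin m) ℂ, ∀ z : CE m, ‖z‖ ≤ R → ‖f z - _root_.pev p z‖ < ε := by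
  obtain ⟨cf, hf⟩ := hf
  have h := hf R
  rw [polyAlg, ← SetLike.mem_coe, Subalgebra.topologicalClosure_coe, Metric.mem_closure_iff] at h
  obtain ⟨b, ⟨p, rfl⟩, hb⟩ := h ε hε
  refine ⟨p, fun z hz => ?_⟩
  have hz' : z ∈ Metric.closedBall (0 : CE m) R := by simpa using hz
  have h1 := (ContinuousMap.dist_apply_le_dist
    (⟨z, hz'⟩ : Metric.closedBall (0 : CE m) R)).trans_lt hb
  rw [dist_eq_norm] at h1
  refine lt_of_eq_of_lt ?_ h1
  congr 2
  exact (aeval_restrict_apply R p ⟨z, hz'⟩).symm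

open MeasureTheory in
theorem integral_mem_of_isClosed {E : Type*} [NormedAddCommGroup E] [NormedSpace ℝ E]
    [CompleteSpace E] (P : Submodule ℝ E) (hP : IsClosed (P : Set E)) {d : ℕ} {G : Rn d → E}
    (hG : Continuous G) (sG : HasCompactSupport G) (hm : ∀ y, G y ∈ P) : ∫ y, G y ∈ P := by
  have : CompleteSpace P := hP.completeSpace_coe
  let G' : Rn d → P := fun y => ⟨G y, hm y⟩
  have cG' : Continuous G' := Continuous.subtype_mk hG _
  have sG' : HasCompactSupport G' := by
    refine HasCompactSupport.intro sG.isCompact fun y hy => ?_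
    ext
    exact (image_eq_zero_of_notMem_tsupport hy : G y = 0)
  have h1 := ContinuousLinearMap.integral_comp_comm P.subtypeL
    (cG'.integrable_of_hasCompactSupport sG' (μ := volume))
  have h2 : (∫ y, G y) = P.subtypeL (∫ y, G' y) := h1
  rw [h2]
  exact (∫ y, G' y).2

open MeasureTheory in
theorem PolyLim.integral {d : ℕ} {F : Rn d → CE m → ℂ}
    (hF : Continuous (fun q : Rn d × CE m => F q.1 q.2))
    (hs : ∃ C : Set (Rn d), IsCompact C ∧ ∀ y ∉ C, ∀ z, F y z = 0)
    (hp : ∀ y, PolyLim (F y)) : PolyLim (fun z => ∫ y, F y z) := by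
  obtain ⟨C, hC, hC0⟩ := hs
  refine ⟨?_, fun R => ?_⟩
  · have h : ∀ z, ∫ y, F y z = ∫ y in C, F y z := fun z =>
      (setIntegral_eq_integral_of_forall_compl_eq_zero fun y hy => hC0 y hy z).symm
    simp only [h]
    exact continuous_parametric_integral_of_continuous (f := fun z y => F y z)
      (hF.comp continuous_swap) hC
  · let G : C(Rn d, C(Metric.closedBall (0 : CE m) R, ℂ)) :=
      ContinuousMap.curry ⟨fun q => F q.1 q.2.1, by fun_prop⟩
    have sG : HasCompactSupport G := by
      refine HasCompactSupport.intro hC fun y hy => ?_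
      ext z
      exact hC0 y hy z
    have h2 : (∫ y, G y) ∈ polyAlg m R :=
      integral_mem_of_isClosed ((Subalgebra.toSubmodule (polyAlg m R)).restrictScalars ℝ)
        (isClosed_polyAlg (m := m) R) G.continuous sG (fun y => (hp y).2 R)
    have iG : Integrable G := G.continuous.integrable_of_hasCompactSupport sG
    convert h2 using 1
    ext z
    exact ContinuousLinearMap.integral_comp_comm
      (ContinuousMap.evalCLM ℂ z : C(Metric.closedBall (0 : CE m) R, ℂ) →L[ℂ] ℂ) iG

/-- Every point of `L` is separated from `E` by a polynomial, with a margin. -/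
def PolySep (L E : Set (CE m)) : Prop :=
  ∀ z ∈ L, ∃ (p : MvPolynomial (Fin m) ℂ) (c : ℝ), 0 ≤ c ∧ c < ‖pev p z‖ ∧ ∀ w ∈ E, ‖pev p w‖ ≤ c

theorem PolySep.mono {L L' E E' : Set (CE m)} (h : PolySep L E) (hL : L' ⊆ L) (hE : E' ⊆ E) :
    PolySep L' E' := fun z hz =>
  let ⟨p, c, h0, h1, h2⟩ := h z (hL hz)
  ⟨p, c, h0, h1, fun w hw => h2 w (hE hw)⟩

theorem IsPolyConvex.sep {K : Set (CE m)} (h : IsPolyConvex K) (hK : IsCompact K)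
    {L : Set (CE m)} (hL : Disjoint L K) : PolySep L K := by
  intro z hz
  obtain ⟨p, hp⟩ := h z (Set.disjoint_left.1 hL hz)
  rcases K.eq_empty_or_nonempty with rfl | hne
  · exact ⟨1, 0, le_rfl, by simp [pev], by simp⟩
  · obtain ⟨w, hw, hmax⟩ := hK.exists_isMaxOn hne (continuous_pev p).norm.continuousOn
    exact ⟨p, ‖pev p w‖, norm_nonneg _, hp w hw, fun v hv => hmax hv⟩

theorem IsPolyConvex.of_sep {E : Set (CE m)} (h : PolySep Eᶜ E) : IsPolyConvex E := by
  intro z hz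
  obtain ⟨p, c, -, h1, h2⟩ := h z hz
  exact ⟨p, fun w hw => (h2 w hw).trans_lt h1⟩

theorem PolySep.union_left {L L' E : Set (CE m)} (h : PolySep L E) (h' : PolySep L' E) :
    PolySep (L ∪ L') E :=
  fun z hz => hz.elim (h z) (h' z)

theorem PolySep.exists_thickening {L E : Set (CE m)} (hL : IsCompact L) (hE : Bornology.IsBounded E)
    (h : PolySep L E) : ∃ ε > 0, PolySep L (Metric.thickening ε E) := by
  refine hL.induction_on (p := fun s => ∃ ε > 0, PolySep s (Metric.thickening ε E)) ?_ ?_ ?_ ?_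
  · exact ⟨1, one_pos, fun z hz => hz.elim⟩
  · rintro s t hst ⟨ε, h0, h1⟩
    exact ⟨ε, h0, h1.mono hst le_rfl⟩
  · rintro s t ⟨ε, h0, h1⟩ ⟨ε', h0', h1'⟩
    exact ⟨min ε ε', lt_min h0 h0', PolySep.union_left
      (h1.mono le_rfl (Metric.thickening_mono (min_le_left _ _) _))
      (h1'.mono le_rfl (Metric.thickening_mono (min_le_right _ _) _))⟩
  · intro z hz
    obtain ⟨p, c, hc0, hc, hcE⟩ := h z hz
    obtain ⟨c', hcc', hc'⟩ := exists_between hc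
    refine ⟨{x | c' < ‖pev p x‖}, mem_nhdsWithin_of_mem_nhds
      ((isOpen_lt continuous_const (continuous_pev p).norm).mem_nhds hc'), ?_⟩
    have hcomp : IsCompact (Metric.cthickening 1 E) :=
      Metric.isCompact_of_isClosed_isBounded Metric.isClosed_cthickening hE.cthickening
    have huc := hcomp.uniformContinuousOn_of_continuous (continuous_pev p).continuousOn
    rw [Metric.uniformContinuousOn_iff] at huc
    obtain ⟨δ, hδ, H⟩ := huc (c' - c) (by linarith)
    refine ⟨min δ 1, lt_min hδ one_pos, fun x hx => ⟨p, c', by linarith, hx, fun w hw => ?_⟩⟩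
    obtain ⟨v, hv, hvw⟩ := Metric.mem_thickening_iff.1 hw
    have h1 : w ∈ Metric.cthickening 1 E := by
      apply Metric.thickening_subset_cthickening
      exact Metric.thickening_mono (min_le_right _ _) _ hw
    have h2 : v ∈ Metric.cthickening 1 E := Metric.self_subset_cthickening _ hv
    have h3 := H w h1 v h2 (hvw.trans_le (min_le_left _ _))
    rw [dist_eq_norm] at h3
    have h4 := norm_le_insert' (pev p w) (pev p v)
    have h5 := hcE v hv
    linarith

theorem PolySep.union_zero {L E₁ E₂ : Set (CE m)} (h : PolySep L E₁) (h₁ : Bornology.IsBounded E₁)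
    (h₂ : Bornology.IsBounded E₂) {Q : CE m → ℂ} (hQ : PolyLim Q) (hL : ∀ z ∈ L, Q z ≠ 0)
    (hE : ∀ z ∈ E₂, Q z = 0) : PolySep L (E₁ ∪ E₂) := by
  intro z hz
  obtain ⟨p, c, hc0, hc, hcE⟩ := h z hz
  obtain ⟨R, hR⟩ := ((h₁.union h₂).union (Bornology.isBounded_singleton (x := z))).exists_norm_le
  have hpz : 0 < ‖pev p z‖ := hc0.trans_lt hc
  obtain ⟨C, hC⟩ := (isCompact_closedBall (0 : CE m) R).exists_bound_of_continuousOn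
    hQ.1.continuousOn
  have hC1 : 0 ≤ C := (norm_nonneg _).trans (hC z (by simpa using hR z (by simp)))
  have hQz : 0 < ‖Q z‖ := norm_pos_iff.2 (hL z hz)
  have hr1 : c / ‖pev p z‖ < 1 := (div_lt_one hpz).2 hc
  have hr0 : 0 ≤ c / ‖pev p z‖ := by positivity
  obtain ⟨N, hN⟩ := exists_pow_lt_of_lt_one (show 0 < ‖Q z‖ / (2 * (C + 1)) by positivity) hr1
  have hf : PolyLim (fun w => ((pev p z)⁻¹ * pev p w) ^ N * Q w) :=
    (((PolyLim.const _).mul (PolyLim.pev p)).pow N).mul hQ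
  obtain ⟨q, hq⟩ := hf.approx R (‖Q z‖ / 8) (by positivity)
  refine ⟨q, ‖Q z‖ * (5 / 8), by positivity, ?_, ?_⟩
  · have h1 := hq z (hR z (by simp))
    rw [inv_mul_cancel₀ (norm_pos_iff.1 hpz), one_pow, one_mul] at h1
    have h2 := norm_le_insert' (Q z) (pev q z)
    have : ‖Q z‖ ≤ ‖pev q z‖ + ‖Q z - pev q z‖ := h2
    linarith
  · rintro w (hw | hw)
    · have hwR := hR w (by simp [hw])
      have h1 := hq w hwR
      have h2 := norm_le_insert (((pev p z)⁻¹ * pev p w) ^ N * Q w) (pev q w)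
      have h3 : ‖((pev p z)⁻¹ * pev p w) ^ N * Q w‖ ≤ ‖Q z‖ / 2 := by
        rw [norm_mul, norm_pow, norm_mul, norm_inv]
        have h4 : ‖pev p z‖⁻¹ * ‖pev p w‖ ≤ c / ‖pev p z‖ := by
          rw [div_eq_inv_mul]
          gcongr
          exact hcE w hw
        have h5 : ‖Q w‖ ≤ C := hC w (by simpa using hwR)
        calc (‖pev p z‖⁻¹ * ‖pev p w‖) ^ N * ‖Q w‖
            ≤ (c / ‖pev p z‖) ^ N * C := by gcongr
          _ ≤ ‖Q z‖ / (2 * (C + 1)) * C := by gcongr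
          _ ≤ ‖Q z‖ / 2 := by
            rw [div_mul_eq_mul_div, div_le_div_iff₀ (by positivity) (by positivity)]
            nlinarith
      linarith
    · have h1 := hq w (hR w (by simp [hw]))
      rw [hE w hw, mul_zero, zero_sub, norm_neg] at h1
      linarith

end PolynomialLimits

section DominatedFamilies

open scoped ContDiff

variable {P U E F G : Type} [NormedAddCommGroup P] [NormedSpace ℝ P]
  [NormedAddCommGroup U] [NormedSpace ℝ U] [NormedAddCommGroup E] [NormedSpace ℝ E]
  [NormedAddCommGroup F] [NormedSpace ℝ F] [NormedAddCommGroup G] [NormedSpace ℝ G]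

/-- Smooth functions all of whose derivatives are bounded. -/
def BddDeriv (f : P → F) : Prop :=
  ContDiff ℝ ∞ f ∧ ∀ j : ℕ, ∃ C : ℝ, ∀ p, ‖iteratedFDeriv ℝ j f p‖ ≤ C

/-- Jointly smooth families `f p u` whose derivatives in `p` are bounded by a polynomial in `‖u‖`
times `exp (-w u)`. -/
def DomBy (w : U → ℝ) (f : P → U → F) : Prop :=
  ContDiff ℝ ∞ (Function.uncurry f) ∧ ∀ j : ℕ, ∃ (C : ℝ) (M : ℕ), ∀ p u,
    ‖iteratedFDeriv ℝ j (fun q => f q u) p‖ ≤ C * (1 + ‖u‖) ^ M * Real.exp (-w u)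

theorem HasCompactSupport.bddDeriv {f : P → F} (h : HasCompactSupport f) (hf : ContDiff ℝ ∞ f) :
    BddDeriv f := by
  refine ⟨hf, fun j => ?_⟩
  exact (hf.continuous_iteratedFDeriv (by exact_mod_cast le_top)).bounded_above_of_compact_support
    (h.iteratedFDeriv j)

theorem BddDeriv.fderiv {f : P → F} (h : BddDeriv f) : BddDeriv (fderiv ℝ f) := by
  refine ⟨h.1.fderiv_right le_rfl, fun j => ?_⟩
  obtain ⟨C, hC⟩ := h.2 (j + 1)
  exact ⟨C, fun p => by rw [norm_iteratedFDeriv_fderiv]; exact hC p⟩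

theorem DomBy.contDiff {w : U → ℝ} {f : P → U → F} (h : DomBy w f) (u : U) :
    ContDiff ℝ ∞ (fun p => f p u) :=
  h.1.comp (contDiff_id.prodMk contDiff_const)

theorem DomBy.uniform {w : U → ℝ} {f : P → U → F} (h : DomBy w f) (k : ℕ) :
    ∃ (C : ℝ) (M : ℕ), 0 ≤ C ∧ ∀ j ≤ k, ∀ p u,
      ‖iteratedFDeriv ℝ j (fun q => f q u) p‖ ≤ C * (1 + ‖u‖) ^ M * Real.exp (-w u) := by
  have hle : ∀ {C C' : ℝ} {M M' : ℕ} (u : U), C ≤ C' → 0 ≤ C' → M ≤ M' →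
      C * (1 + ‖u‖) ^ M * Real.exp (-w u) ≤ C' * (1 + ‖u‖) ^ M' * Real.exp (-w u) := by
    intro C C' M M' u h1 h2 h3
    have : (1 : ℝ) ≤ 1 + ‖u‖ := by simp
    gcongr
  induction k with
  | zero =>
    obtain ⟨C, M, hC⟩ := h.2 0
    refine ⟨max C 0, M, le_max_right _ _, fun j hj p u => ?_⟩
    obtain rfl : j = 0 := by omega
    exact (hC p u).trans (hle u (le_max_left _ _) (le_max_right _ _) le_rfl)
  | succ k ih =>
    obtain ⟨C, M, hC0, hC⟩ := ih
    obtain ⟨C', M', hC'⟩ := h.2 (k + 1)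
    refine ⟨max C C', max M M', hC0.trans (le_max_left _ _), fun j hj p u => ?_⟩
    rcases Nat.lt_or_ge j (k + 1) with hj' | hj'
    · exact (hC j (by omega) p u).trans
        (hle u (le_max_left _ _) (hC0.trans (le_max_left _ _)) (le_max_left _ _))
    · obtain rfl : j = k + 1 := by omega
      exact (hC' p u).trans
        (hle u (le_max_right _ _) (hC0.trans (le_max_left _ _)) (le_max_right _ _))

theorem DomBy.fderiv {w : U → ℝ} {f : P → U → F} (h : DomBy w f) :
    DomBy w (fun p u => fderiv ℝ (fun q => f q u) p) := by
  refine ⟨?_, fun j => ?_⟩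
  · have h1 : ContDiff ℝ ∞ (Function.uncurry fun (x : P × U) (q : P) => f q x.2) :=
      h.1.comp (contDiff_snd.prodMk (contDiff_snd.comp contDiff_fst))
    exact ContDiff.fderiv (f := fun (x : P × U) (q : P) => f q x.2) (g := Prod.fst) h1
      contDiff_fst le_rfl
  · obtain ⟨C, M, hC⟩ := h.2 (j + 1)
    refine ⟨C, M, fun p u => ?_⟩
    have := norm_iteratedFDeriv_fderiv (𝕜 := ℝ) (f := fun q => f q u) (x := p) (n := j)
    exact this.trans_le (hC p u)

theorem DomBy.bilin {w w' : U → ℝ} (B : E →L[ℝ] F →L[ℝ] G) {f : P → U → E} {g : P → U → F}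
    (hf : DomBy w f) (hg : DomBy w' g) :
    DomBy (fun u => w u + w' u) (fun p u => B (f p u) (g p u)) := by
  refine ⟨?_, fun j => ?_⟩
  · exact (B.isBoundedBilinearMap.contDiff).comp (hf.1.prodMk hg.1)
  · obtain ⟨C, M, hC0, hC⟩ := hf.uniform j
    obtain ⟨C', M', hC0', hC'⟩ := hg.uniform j
    refine ⟨‖B‖ * ∑ i ∈ Finset.range (j + 1), (j.choose i : ℝ) * C * C', M + M', fun p u => ?_⟩
    refine (B.norm_iteratedFDeriv_le_of_bilinear (hf.contDiff u) (hg.contDiff u) p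
      (by exact_mod_cast le_top)).trans ?_
    rw [mul_assoc, mul_assoc, Finset.sum_mul]
    refine mul_le_mul_of_nonneg_left (Finset.sum_le_sum fun i hi => ?_) (norm_nonneg B)
    rw [neg_add, Real.exp_add, pow_add]
    have h1 := hC i (by simp at hi; omega) p u
    have h2 := hC' (j - i) (by omega) p u
    calc (j.choose i : ℝ) * ‖iteratedFDeriv ℝ i (fun q => f q u) p‖ *
          ‖iteratedFDeriv ℝ (j - i) (fun q => g q u) p‖
        ≤ (j.choose i : ℝ) * (C * (1 + ‖u‖) ^ M * Real.exp (-w u)) *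
          (C' * (1 + ‖u‖) ^ M' * Real.exp (-w' u)) := by gcongr
      _ = _ := by ring

theorem BddDeriv.domBy_comp {f : E → F} (hf : BddDeriv f) (T : U → P →L[ℝ] E)
    (hT : ContDiff ℝ ∞ (fun q : P × U => T q.2 q.1)) (hn : ∀ u, ‖T u‖ ≤ 1 + ‖u‖) :
    DomBy 0 (fun p (u : U) => f (T u p)) := by
  refine ⟨hf.1.comp hT, fun j => ?_⟩
  obtain ⟨C, hC⟩ := hf.2 j
  refine ⟨C, j, fun p u => ?_⟩
  have h := (T u).iteratedFDeriv_comp_right hf.1 p (i := j) (by exact_mod_cast le_top)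
  change ‖iteratedFDeriv ℝ j (f ∘ T u) p‖ ≤ _
  rw [h]
  refine (ContinuousMultilinearMap.norm_compContinuousLinearMap_le _ _).trans ?_
  simp only [Finset.prod_const, Finset.card_univ, Fintype.card_fin, Pi.zero_apply, neg_zero,
    Real.exp_zero, mul_one]
  have := hC (T u p)
  have h0 : 0 ≤ C := (norm_nonneg _).trans this
  gcongr
  exact hn u

theorem domBy_const {h : U → F} (hh : ContDiff ℝ ∞ h) {C : ℝ} {M : ℕ}
    (hb : ∀ u, ‖h u‖ ≤ C * (1 + ‖u‖) ^ M) : DomBy (P := P) 0 (fun _ u => h u) := by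
  refine ⟨hh.comp contDiff_snd, fun j => ?_⟩
  rcases Nat.eq_zero_or_pos j with rfl | hj
  · exact ⟨C, M, fun p u => by simpa using hb u⟩
  · refine ⟨0, 0, fun p u => ?_⟩
    rw [iteratedFDeriv_const_of_ne (by omega)]
    simp

theorem exists_norm_iteratedFDeriv_cexp_le (i : ℕ) :
    ∃ C : ℝ, ∀ z : ℂ, ‖iteratedFDeriv ℝ i Complex.exp z‖ ≤ C * ‖Complex.exp z‖ := by
  refine ⟨‖iteratedFDeriv ℝ i Complex.exp 0‖, fun z => ?_⟩
  have h : (fun v : ℂ => Complex.exp (z + v)) = fun v => Complex.exp z • Complex.exp v := by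
    ext v
    rw [Complex.exp_add, smul_eq_mul]
  have h1 := iteratedFDeriv_comp_add_left (𝕜 := ℝ) (f := Complex.exp) i z 0
  have h2 : ContDiff ℝ ∞ Complex.exp := Complex.contDiff_exp
  rw [h, iteratedFDeriv_const_smul_apply'
    (by exact (h2.of_le (by exact_mod_cast le_top)).contDiffAt),
    add_zero] at h1
  rw [← h1, norm_smul, mul_comm]

theorem DomBy.cexp {w : U → ℝ} {S : P → U → ℂ} (hS : DomBy 0 S) (hw : ∀ p u, w u ≤ (S p u).re) :
    DomBy w (fun p u => Complex.exp (-S p u)) := by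
  have hexp : ContDiff ℝ ∞ Complex.exp := Complex.contDiff_exp
  refine ⟨hexp.comp hS.1.neg, fun j => ?_⟩
  obtain ⟨C, M, hC0, hC⟩ := hS.uniform j
  choose c hc using exists_norm_iteratedFDeriv_cexp_le
  let c' : ℝ := ∑ i ∈ Finset.range (j + 1), |c i|
  refine ⟨j.factorial * c' * (1 + C) ^ j, M * j, fun p u => ?_⟩
  have h := norm_iteratedFDeriv_comp_le (n := j) hexp (hS.contDiff u).neg (by exact_mod_cast le_top)
    p (C := c' * Real.exp (-w u)) (D := (1 + C) * (1 + ‖u‖) ^ M) ?_ ?_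
  · refine h.trans (le_of_eq ?_)
    rw [mul_pow, ← pow_mul]
    generalize (1 + C) ^ j = a
    ring
  · intro i hi
    refine (hc i _).trans ?_
    rw [Complex.norm_exp]
    have h1 : c i ≤ c' := (le_abs_self _).trans
      (Finset.single_le_sum (f := fun i => |c i|) (fun _ _ => abs_nonneg _)
        (Finset.mem_range.2 (by omega)))
    have h2 : 0 ≤ c' := Finset.sum_nonneg fun _ _ => abs_nonneg _
    have h3 := hw p u
    gcongr
    simpa using h3
  · intro i hi hij
    have h1 : ‖iteratedFDeriv ℝ i (fun q => -S q u) p‖ =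
        ‖iteratedFDeriv ℝ i (fun q => S q u) p‖ := by
      have := iteratedFDeriv_neg_apply (𝕜 := ℝ) (i := i) (f := fun q => S q u) (x := p)
      change ‖iteratedFDeriv ℝ i (-fun q => S q u) p‖ = _
      rw [this, norm_neg]
    have h2 := hC i hij p u
    simp only [Pi.zero_apply, neg_zero, Real.exp_zero, mul_one] at h2
    rw [h1]
    refine h2.trans ?_
    have h3 : (1 : ℝ) ≤ (1 + ‖u‖) ^ M := one_le_pow₀ (by simp)
    have h4 : (1 : ℝ) ≤ (1 + C) * (1 + ‖u‖) ^ M := by nlinarith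
    calc C * (1 + ‖u‖) ^ M ≤ (1 + C) * (1 + ‖u‖) ^ M := by gcongr; linarith
      _ ≤ _ := le_self_pow₀ h4 (by omega)

open MeasureTheory in
theorem DomBy.integral [FiniteDimensional ℝ P] [FiniteDimensional ℝ U] [MeasurableSpace U]
    [BorelSpace U] [CompleteSpace F] {μ : Measure U} {w : U → ℝ}
    (hw : ∀ M : ℕ, Integrable (fun u => (1 + ‖u‖) ^ M * Real.exp (-w u)) μ)
    {f : P → U → F} (hf : DomBy w f) : BddDeriv (fun p => ∫ u, f p u ∂μ) := by
  have key : ∀ {G : Type} [NormedAddCommGroup G] [NormedSpace ℝ G] [CompleteSpace G]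
      {f : P → U → G}, DomBy w f →
      (∃ C, ∀ p, ‖∫ u, f p u ∂μ‖ ≤ C) ∧ Continuous (fun p => ∫ u, f p u ∂μ) ∧
      ∀ p, HasFDerivAt (fun p => ∫ u, f p u ∂μ) (∫ u, _root_.fderiv ℝ (fun q => f q u) p ∂μ) p := by
    intro G _ _ _ f hf
    obtain ⟨C, M, hC⟩ := hf.2 0
    simp only [norm_iteratedFDeriv_zero] at hC
    have h_int : Integrable (fun u => C * (1 + ‖u‖) ^ M * Real.exp (-w u)) μ := by
      simpa [mul_assoc] using (hw M).const_mul C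
    have hm : ∀ p, AEStronglyMeasurable (f p) μ := fun p =>
      (hf.1.continuous.comp (by fun_prop : Continuous fun u : U => (p, u))).aestronglyMeasurable
    have hi : ∀ p, Integrable (f p) μ := fun p =>
      h_int.mono' (hm p) (Filter.Eventually.of_forall fun u => hC p u)
    have hd : ∀ p, HasFDerivAt (fun p => ∫ u, f p u ∂μ)
        (∫ u, _root_.fderiv ℝ (fun q => f q u) p ∂μ) p := by
      intro p
      have hf' := hf.fderiv
      obtain ⟨C', M', hC'⟩ := hf'.2 0
      simp only [norm_iteratedFDeriv_zero] at hC'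
      have h_int' : Integrable (fun u => C' * (1 + ‖u‖) ^ M' * Real.exp (-w u)) μ := by
        simpa [mul_assoc] using (hw M').const_mul C'
      refine hasFDerivAt_integral_of_dominated_of_fderiv_le (F' := fun p u =>
        _root_.fderiv ℝ (fun q => f q u) p) (s := univ) Filter.univ_mem
        (Filter.Eventually.of_forall hm) (hi p) ?_
        (Filter.Eventually.of_forall fun u q _ => hC' q u) h_int'
        (Filter.Eventually.of_forall fun u q _ =>
          ((hf.contDiff u).differentiable (by simp)).differentiableAt.hasFDerivAt)
      exact (hf'.1.continuous.comp
        (by fun_prop : Continuous fun u : U => (p, u))).aestronglyMeasurable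
    refine ⟨⟨∫ u, C * (1 + ‖u‖) ^ M * Real.exp (-w u) ∂μ, fun p =>
      norm_integral_le_of_norm_le h_int (Filter.Eventually.of_forall fun u => hC p u)⟩,
      continuous_iff_continuousAt.2 fun p => (hd p).continuousAt, hd⟩
  have hder : ∀ {G : Type} [NormedAddCommGroup G] [NormedSpace ℝ G] [CompleteSpace G]
      {f : P → U → G}, DomBy w f → _root_.fderiv ℝ (fun p => ∫ u, f p u ∂μ) =
        fun p => ∫ u, _root_.fderiv ℝ (fun q => f q u) p ∂μ := by
    intro G _ _ _ f hf
    ext1 p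
    exact ((key hf).2.2 p).fderiv
  refine ⟨contDiff_infty.2 fun n => ?_, fun j => ?_⟩
  · induction n generalizing F with
    | zero => exact contDiff_zero.2 (key hf).2.1
    | succ n ih =>
      push_cast
      exact contDiff_succ_iff_hasFDerivAt.2 ⟨_, ih hf.fderiv, (key hf).2.2⟩
  · induction j generalizing F with
    | zero =>
      simp only [norm_iteratedFDeriv_zero]
      exact (key hf).1
    | succ j ih =>
      obtain ⟨C, hC⟩ := ih hf.fderiv
      refine ⟨C, fun p => ?_⟩
      rw [← norm_iteratedFDeriv_fderiv, hder hf]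
      exact hC p

end DominatedFamilies

section SmallFamilies

open scoped ContDiff

variable {P U E F G I : Type} [NormedAddCommGroup P] [NormedSpace ℝ P]
  [NormedAddCommGroup U] [NormedSpace ℝ U] [NormedAddCommGroup E] [NormedSpace ℝ E]
  [NormedAddCommGroup F] [NormedSpace ℝ F] [NormedAddCommGroup G] [NormedSpace ℝ G]

theorem one_add_pow_mul_exp_le (M : ℕ) {c t : ℝ} (hc : 0 < c) (ht : 0 ≤ t) :
    (1 + t) ^ M * Real.exp (-(c * t ^ 2)) ≤
      M.factorial * Real.exp (1 + 1 / (2 * c)) * Real.exp (-(c / 2 * t ^ 2)) := by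
  have h1 : (1 + t) ^ M ≤ M.factorial * Real.exp (1 + t) := by
    have := Real.pow_div_factorial_le_exp (1 + t) (by positivity) M
    rw [div_le_iff₀ (by positivity)] at this
    linarith
  have h2 : 1 + t - c * t ^ 2 ≤ 1 + 1 / (2 * c) - c / 2 * t ^ 2 := by
    have : 0 ≤ c / 2 * (t - 1 / c) ^ 2 := by positivity
    have h3 : c / 2 * (t - 1 / c) ^ 2 = c / 2 * t ^ 2 - t + 1 / (2 * c) := by
      field_simp
      ring
    linarith
  calc (1 + t) ^ M * Real.exp (-(c * t ^ 2))
      ≤ M.factorial * Real.exp (1 + t) * Real.exp (-(c * t ^ 2)) := by gcongr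
    _ = M.factorial * Real.exp (1 + t - c * t ^ 2) := by
      rw [mul_assoc, ← Real.exp_add, ← sub_eq_add_neg]
    _ ≤ M.factorial * Real.exp (1 + 1 / (2 * c) - c / 2 * t ^ 2) := by gcongr
    _ = _ := by rw [mul_assoc, ← Real.exp_add, ← sub_eq_add_neg]

open MeasureTheory in
theorem integrable_one_add_pow_mul_exp {d : ℕ} {c : ℝ} (hc : 0 < c) (M : ℕ) :
    Integrable (fun u : Rn d => (1 + ‖u‖) ^ M * Real.exp (-(c * ‖u‖ ^ 2))) := by
  have h1 : Integrable (fun u : Rn d => Real.exp (-(c / 2 * ‖u‖ ^ 2))) := by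
    have h := (GaussianFourier.integrable_cexp_neg_mul_sq_norm_add (V := Rn d) (b := (c / 2 : ℝ))
      (by simpa using hc) 0 0).norm
    refine h.congr (Filter.Eventually.of_forall fun u => ?_)
    simp only [Complex.norm_exp]
    congr 1
    simp [← Complex.ofReal_pow]
  refine (h1.const_mul (M.factorial * Real.exp (1 + 1 / (2 * c)))).mono'
    (by fun_prop) (Filter.Eventually.of_forall fun u => ?_)
  rw [Real.norm_of_nonneg (by positivity)]
  exact one_add_pow_mul_exp_le M hc (norm_nonneg u)

/-- Families of smooth functions that tend to `0` uniformly together with each of their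
derivatives. -/
def TendsC (u : I → P → F) (l : Filter I) : Prop :=
  (∀ i, ContDiff ℝ ∞ (u i)) ∧ ∀ j : ℕ, ∀ ε : ℝ, 0 < ε →
    ∀ᶠ i in l, ∀ p, ‖iteratedFDeriv ℝ j (u i) p‖ ≤ ε

/-- All derivatives of `f` up to order `k` are bounded by `ε`. -/
def Csmall (k : ℕ) (ε : ℝ) (f : P → F) : Prop :=
  ∀ j ≤ k, ∀ p, ‖iteratedFDeriv ℝ j f p‖ ≤ ε

theorem TendsC.csmall {u : I → P → F} {l : Filter I} (h : TendsC u l) (k : ℕ) {ε : ℝ}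
    (hε : 0 < ε) : ∀ᶠ i in l, Csmall k ε (u i) := by
  have := (Filter.eventually_all_finset (l := l) (Finset.range (k + 1))
    (p := fun j i => ∀ p, ‖iteratedFDeriv ℝ j (u i) p‖ ≤ ε)).2 fun j _ => h.2 j ε hε
  filter_upwards [this] with i hi j hj p
  exact hi j (Finset.mem_range.2 (by omega)) p

theorem TendsC.add {u v : I → P → F} {l : Filter I} (hu : TendsC u l) (hv : TendsC v l) :
    TendsC (fun i p => u i p + v i p) l := by
  refine ⟨fun i => (hu.1 i).add (hv.1 i), fun j ε hε => ?_⟩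
  filter_upwards [hu.2 j (ε / 2) (by positivity), hv.2 j (ε / 2) (by positivity)] with i h1 h2 p
  rw [fun_iteratedFDeriv_add_apply (((hu.1 i).of_le (by exact_mod_cast le_top)).contDiffAt)
    (((hv.1 i).of_le (by exact_mod_cast le_top)).contDiffAt)]
  exact (norm_add_le _ _).trans (by linarith [h1 p, h2 p])

theorem TendsC.bilin {u : I → P → F} {l : Filter I} (hu : TendsC u l) {a : P → E} (ha : BddDeriv a)
    (B : E →L[ℝ] F →L[ℝ] G) : TendsC (fun i p => B (a p) (u i p)) l := by
  refine ⟨fun i => (B.isBoundedBilinearMap.contDiff).comp (ha.1.prodMk (hu.1 i)),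
    fun j ε hε => ?_⟩
  choose C hC using ha.2
  set D : ℝ := ‖B‖ * ∑ i ∈ Finset.range (j + 1), (j.choose i : ℝ) * |C i| with hD
  have hD0 : 0 ≤ D := by positivity
  filter_upwards [hu.csmall j (ε := ε / (D + 1)) (by positivity)] with i hi p
  refine (B.norm_iteratedFDeriv_le_of_bilinear ha.1 (hu.1 i) p (by exact_mod_cast le_top)).trans ?_
  calc ‖B‖ * ∑ n ∈ Finset.range (j + 1), (j.choose n : ℝ) * ‖iteratedFDeriv ℝ n a p‖ *
        ‖iteratedFDeriv ℝ (j - n) (u i) p‖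
      ≤ ‖B‖ * ∑ n ∈ Finset.range (j + 1), (j.choose n : ℝ) * |C n| * (ε / (D + 1)) := by
        gcongr with n hn
        · exact (hC n p).trans (le_abs_self _)
        · exact hi _ (by omega) p
    _ = D * (ε / (D + 1)) := by rw [← Finset.sum_mul, hD]; ring
    _ ≤ ε := by
      rw [mul_div_assoc', div_le_iff₀ (by positivity)]
      nlinarith

theorem TendsC.comp_clm {u : I → P → F} {l : Filter I} (hu : TendsC u l) (T : E →L[ℝ] P) :
    TendsC (fun i p => u i (T p)) l := by
  refine ⟨fun i => (hu.1 i).comp T.contDiff, fun j ε hε => ?_⟩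
  filter_upwards [hu.2 j (ε / (‖T‖ ^ j + 1)) (by positivity)] with i hi p
  have h := T.iteratedFDeriv_comp_right (hu.1 i) p (i := j) (by exact_mod_cast le_top)
  change ‖iteratedFDeriv ℝ j (u i ∘ T) p‖ ≤ _
  rw [h]
  refine (ContinuousMultilinearMap.norm_compContinuousLinearMap_le _ _).trans ?_
  simp only [Finset.prod_const, Finset.card_univ, Fintype.card_fin]
  have h1 := hi (T p)
  have h2 : 0 ≤ ‖T‖ ^ j := by positivity
  calc _ ≤ ε / (‖T‖ ^ j + 1) * ‖T‖ ^ j := by gcongr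
    _ ≤ ε := by
      rw [div_mul_eq_mul_div, div_le_iff₀ (by positivity)]
      nlinarith

theorem TendsC.fderiv {u : I → P → F} {l : Filter I} (hu : TendsC u l) :
    TendsC (fun i => fderiv ℝ (u i)) l := by
  refine ⟨fun i => (hu.1 i).fderiv_right le_rfl, fun j ε hε => ?_⟩
  filter_upwards [hu.2 (j + 1) ε hε] with i hi p
  rw [norm_iteratedFDeriv_fderiv]
  exact hi p

theorem TendsC.of_tendsto {I' : Type} {u : I → P → F} {l : Filter I} (hu : TendsC u l)
    {l' : Filter I'} {g : I' → I} (hg : Filter.Tendsto g l' l) : TendsC (fun i => u (g i)) l' :=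
  ⟨fun _ => hu.1 _, fun j ε hε => hg.eventually (hu.2 j ε hε)⟩

theorem DomBy.tendsC {w : U → ℝ} {f : P → U → F} (hf : DomBy w f) {l : Filter U}
    (hw : ∀ M : ℕ, Filter.Tendsto (fun u => (1 + ‖u‖) ^ M * Real.exp (-w u)) l (𝓝 0)) :
    TendsC (fun u p => f p u) l := by
  refine ⟨hf.contDiff, fun j ε hε => ?_⟩
  obtain ⟨C, M, hC⟩ := hf.2 j
  have h := (hw M).const_mul C
  rw [mul_zero] at h
  filter_upwards [h.eventually (gt_mem_nhds hε)] with u hu p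
  exact (hC p u).trans (by rw [mul_assoc]; exact hu.le)

theorem BddDeriv.tendsC_sub {Φ : P × ℝ → F} (h : BddDeriv Φ) :
    TendsC (fun s p => Φ (p, s) - Φ (p, 0)) (𝓝 0) := by
  have hs : ∀ s : ℝ, ContDiff ℝ ∞ (fun p => Φ (p, s)) := fun s =>
    h.1.comp (contDiff_id.prodMk contDiff_const)
  refine ⟨fun s => (hs s).sub (hs 0), fun j ε hε => ?_⟩
  obtain ⟨C, hC⟩ := h.2 (j + 1)
  have hform : ∀ s p, iteratedFDeriv ℝ j (fun p => Φ (p, s)) p =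
      (iteratedFDeriv ℝ j Φ (p, s)).compContinuousLinearMap
        fun _ => ContinuousLinearMap.inl ℝ P ℝ := by
    intro s p
    have h1 : ContDiff ℝ ∞ (fun q => Φ (q + (0, s))) := h.1.comp (contDiff_id.add contDiff_const)
    have h2 := (ContinuousLinearMap.inl ℝ P ℝ).iteratedFDeriv_comp_right h1 p (i := j)
      (by exact_mod_cast le_top)
    rw [iteratedFDeriv_comp_add_right] at h2
    simpa [Function.comp_def] using h2
  have hC0 : 0 ≤ C := (norm_nonneg _).trans (hC 0)
  have hin : ‖ContinuousLinearMap.inl ℝ P ℝ‖ ≤ 1 :=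
    ContinuousLinearMap.opNorm_le_bound _ zero_le_one fun x => by simp
  have hev : ∀ᶠ s : ℝ in 𝓝 0, C * |s| < ε := by
    have : Filter.Tendsto (fun s : ℝ => C * |s|) (𝓝 0) (𝓝 (C * |(0 : ℝ)|)) :=
      (continuous_const.mul continuous_abs).tendsto 0
    rw [abs_zero, mul_zero] at this
    exact this.eventually (gt_mem_nhds hε)
  filter_upwards [hev] with s hs' p
  rw [show (fun p => Φ (p, s) - Φ (p, 0)) = (fun p => Φ (p, s)) - fun p => Φ (p, 0) from rfl,
    iteratedFDeriv_sub_apply (((hs s).of_le (by exact_mod_cast le_top)).contDiffAt)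
      (((hs 0).of_le (by exact_mod_cast le_top)).contDiffAt), hform, hform]
  have hlip : ‖iteratedFDeriv ℝ j Φ (p, s) - iteratedFDeriv ℝ j Φ (p, 0)‖ ≤ C * |s| := by
    have := Convex.norm_image_sub_le_of_norm_fderiv_le (𝕜 := ℝ) (s := univ)
      (f := iteratedFDeriv ℝ j Φ) (C := C) (x := (p, 0)) (y := (p, s))
      (fun x _ => (h.1.differentiable_iteratedFDeriv (by exact_mod_cast WithTop.coe_lt_top j)) x)
      (fun x _ => by rw [norm_fderiv_iteratedFDeriv]; exact hC x) convex_univ trivial trivial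
    simpa using this
  have hcomp : (iteratedFDeriv ℝ j Φ (p, s)).compContinuousLinearMap
        (fun _ => ContinuousLinearMap.inl ℝ P ℝ) -
          (iteratedFDeriv ℝ j Φ (p, 0)).compContinuousLinearMap
        (fun _ => ContinuousLinearMap.inl ℝ P ℝ) =
      (iteratedFDeriv ℝ j Φ (p, s) - iteratedFDeriv ℝ j Φ (p, 0)).compContinuousLinearMap
        fun _ => ContinuousLinearMap.inl ℝ P ℝ := rfl
  rw [hcomp]
  refine (ContinuousMultilinearMap.norm_compContinuousLinearMap_le _ _).trans ?_
  simp only [Finset.prod_const, Finset.card_univ, Fintype.card_fin]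
  calc _ ≤ C * |s| * 1 ^ j := by gcongr
    _ ≤ ε := by rw [one_pow, mul_one]; exact hs'.le

theorem BddDeriv.const (c : F) : BddDeriv (fun _ : P => c) := by
  refine ⟨contDiff_const, fun j => ?_⟩
  rcases Nat.eq_zero_or_pos j with rfl | hj
  · exact ⟨‖c‖, fun p => by simp⟩
  · exact ⟨0, fun p => by rw [iteratedFDeriv_const_of_ne (by omega)]; simp⟩

theorem BddDeriv.add {f g : P → F} (hf : BddDeriv f) (hg : BddDeriv g) :
    BddDeriv (fun p => f p + g p) := by
  refine ⟨hf.1.add hg.1, fun j => ?_⟩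
  obtain ⟨C, hC⟩ := hf.2 j
  obtain ⟨C', hC'⟩ := hg.2 j
  refine ⟨C + C', fun p => ?_⟩
  rw [fun_iteratedFDeriv_add_apply ((hf.1.of_le (by exact_mod_cast le_top)).contDiffAt)
    ((hg.1.of_le (by exact_mod_cast le_top)).contDiffAt)]
  exact (norm_add_le _ _).trans (add_le_add (hC p) (hC' p))

theorem BddDeriv.domBy {f : P → F} (hf : BddDeriv f) : DomBy 0 (fun p (_ : U) => f p) :=
  hf.domBy_comp (fun _ => ContinuousLinearMap.id ℝ P) contDiff_fst fun u =>
    ContinuousLinearMap.norm_id_le.trans (by simp)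

theorem BddDeriv.tendsC_cexp {f : P → ℂ} (hf : BddDeriv f) {δ : ℝ} (hδ : 0 < δ)
    (hre : ∀ p, (f p).re ≤ -δ) :
    TendsC (fun (t : ℝ) p => Complex.exp (t ^ 2 * f p)) Filter.atTop := by
  have h1 : DomBy (P := P) 0 (fun _ (t : ℝ) => (-(t : ℂ) ^ 2)) := by
    refine domBy_const (C := 1) (M := 2) ?_ fun t => ?_
    · exact (Complex.ofRealCLM.contDiff.pow 2).neg
    · rw [norm_neg, norm_pow, Complex.norm_real, one_mul]
      gcongr
      linarith
  have h2 : DomBy (P := P) (0 : ℝ → ℝ) (fun p (t : ℝ) => -(t : ℂ) ^ 2 * f p) := by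
    have h := DomBy.bilin (ContinuousLinearMap.mul ℝ ℂ) h1 (hf.domBy (U := ℝ))
    simp only [Pi.zero_apply, add_zero] at h
    exact h
  have h3 := h2.cexp (w := fun t => δ * t ^ 2) fun p t => by
    have := hre p
    rw [neg_mul, Complex.neg_re, ← Complex.ofReal_pow, Complex.re_ofReal_mul]
    nlinarith [sq_nonneg t]
  simp only [neg_mul, neg_neg] at h3
  refine h3.tendsC fun M => ?_
  have hlim : Filter.Tendsto (fun t : ℝ => M.factorial * Real.exp (1 + 1 / (2 * δ)) *
      Real.exp (-(δ / 2 * t ^ 2))) Filter.atTop (𝓝 0) := by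
    rw [← mul_zero ((M.factorial : ℝ) * Real.exp (1 + 1 / (2 * δ)))]
    refine Filter.Tendsto.const_mul _ (Real.tendsto_exp_neg_atTop_nhds_zero.comp ?_)
    exact (Filter.tendsto_pow_atTop (by norm_num)).const_mul_atTop (by positivity)
  refine squeeze_zero (fun t => by positivity) (fun t => ?_) hlim
  have := one_add_pow_mul_exp_le M hδ (abs_nonneg t)
  rwa [sq_abs] at this

end SmallFamilies

section GaussKernel

open scoped ContDiff

variable {d : ℕ}

/-- The inclusion `ℝ^d → ℂ^d`. -/
def realIncl (d : ℕ) : Rn d →L[ℝ] CE d :=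
  LinearMap.toContinuousLinearMap
    { toFun := fun x => WithLp.toLp 2 fun i => (x i : ℂ)
      map_add' := fun x y => by ext i; simp
      map_smul' := fun c x => by ext i; simp }

@[simp] theorem realIncl_apply (x : Rn d) (i : Fin d) : realIncl d x i = (x i : ℂ) := rfl

theorem norm_realIncl (x : Rn d) : ‖realIncl d x‖ = ‖x‖ := by
  simp [EuclideanSpace.norm_eq]

theorem norm_sum_mul_le (w w' : CE d) : ‖∑ i, w i * w' i‖ ≤ ‖w‖ * ‖w'‖ := by
  refine (norm_sum_le _ _).trans ?_
  simp only [norm_mul]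
  rw [EuclideanSpace.norm_eq, EuclideanSpace.norm_eq]
  exact Real.sum_mul_le_sqrt_mul_sqrt _ _ _

/-- The standard complex bilinear form on `ℂ^d`, as a real bilinear map. -/
def dotC (d : ℕ) : CE d →L[ℝ] CE d →L[ℝ] ℂ :=
  LinearMap.mkContinuous₂ (LinearMap.mk₂ ℝ (fun w w' : CE d => ∑ i, w i * w' i)
    (fun w w' z => by simp [add_mul, Finset.sum_add_distrib])
    (fun c w w' => by simp [Finset.mul_sum, mul_assoc])
    (fun w w' z => by simp [mul_add, Finset.sum_add_distrib])
    (fun c w w' => by simp [Finset.mul_sum, mul_left_comm])) 1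
    (fun w w' => by simpa using norm_sum_mul_le w w')

theorem dotC_apply (w w' : CE d) : dotC d w w' = ∑ i, w i * w' i := rfl

theorem norm_dotC_le (w w' : CE d) : ‖dotC d w w'‖ ≤ ‖w‖ * ‖w'‖ := norm_sum_mul_le w w'

theorem dotC_comm (w w' : CE d) : dotC d w w' = dotC d w' w := by
  simp only [dotC_apply, mul_comm]

theorem dotC_realIncl (u : Rn d) : dotC d (realIncl d u) (realIncl d u) = ((‖u‖ ^ 2 : ℝ) : ℂ) := by
  rw [dotC_apply, EuclideanSpace.real_norm_sq_eq]
  push_cast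
  simp [sq]

theorem norm_dotC_sub_le {η : ℝ} (h0 : 0 ≤ η) (h1 : η ≤ 1) (A : Rn d →L[ℝ] CE d) (hA : ‖A‖ ≤ η)
    (u : Rn d) : ‖dotC d ((realIncl d + A) u) ((realIncl d + A) u) - ((‖u‖ ^ 2 : ℝ) : ℂ)‖ ≤
      3 * η * ‖u‖ ^ 2 := by
  have h : dotC d ((realIncl d + A) u) ((realIncl d + A) u) - ((‖u‖ ^ 2 : ℝ) : ℂ) =
      2 * dotC d (realIncl d u) (A u) + dotC d (A u) (A u) := by
    rw [← dotC_realIncl, add_apply]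
    simp only [map_add, add_apply]
    rw [dotC_comm (A u) (realIncl d u)]
    ring
  rw [h]
  have hAu : ‖A u‖ ≤ η * ‖u‖ := A.le_of_opNorm_le hA u
  refine (norm_add_le _ _).trans ?_
  rw [norm_mul]
  have e1 := norm_dotC_le (realIncl d u) (A u)
  have e2 := norm_dotC_le (A u) (A u)
  rw [norm_realIncl] at e1
  have e3 : ‖u‖ * ‖A u‖ ≤ ‖u‖ * (η * ‖u‖) := by gcongr
  have e4 : ‖A u‖ * ‖A u‖ ≤ (η * ‖u‖) * (1 * ‖u‖) := by
    have : η * ‖u‖ ≤ 1 * ‖u‖ := by gcongr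
    exact mul_le_mul hAu (hAu.trans this) (norm_nonneg _) (by positivity)
  have : ‖(2 : ℂ)‖ = 2 := by simp
  rw [this]
  nlinarith

theorem re_dotC_ge (A : Rn d →L[ℝ] CE d) (hA : ‖A‖ ≤ 1 / 6)
    (u : Rn d) : 1 / 2 * ‖u‖ ^ 2 ≤ (dotC d ((realIncl d + A) u) ((realIncl d + A) u)).re := by
  have h := (Complex.abs_re_le_norm _).trans
    (norm_dotC_sub_le (by norm_num) (by norm_num) A hA u)
  rw [Complex.sub_re, Complex.ofReal_re, abs_le] at h
  linarith [h.1]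

open MeasureTheory

theorem integrable_mul_gauss (M : ℕ) : Integrable (fun u : Rn d =>
    (1 + ‖u‖) ^ M * Real.exp (-(1 / 2 * ‖u‖ ^ 2))) :=
  integrable_one_add_pow_mul_exp (by norm_num) M

/-- There is a bound below which linear perturbations of `ℝ^d → ℂ^d` have nonvanishing
Gauss integral. -/
theorem exists_integral_gauss_ne_zero (d : ℕ) : ∃ η : ℝ, 0 < η ∧ η ≤ 1 / 6 ∧
    ∀ A : Rn d →L[ℝ] CE d, ‖A‖ ≤ η →
      (∫ u : Rn d, Complex.exp (-dotC d ((realIncl d + A) u) ((realIncl d + A) u))) ≠ 0 := by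
  have hI : Integrable (fun u : Rn d => Real.exp (-‖u‖ ^ 2)) := by
    simpa using integrable_one_add_pow_mul_exp (d := d) (c := 1) (by norm_num) 0
  have hI0 : 0 < ∫ u : Rn d, Real.exp (-‖u‖ ^ 2) := integral_exp_pos hI
  set C : ℝ := ∫ u : Rn d, (1 + ‖u‖) ^ 2 * Real.exp (-(1 / 2 * ‖u‖ ^ 2)) with hC
  have hC0 : 0 ≤ C := integral_nonneg fun u => by positivity
  set I0 := ∫ u : Rn d, Real.exp (-‖u‖ ^ 2) with hI0'
  refine ⟨min (1 / 6) (I0 / (6 * (C + 1))), by positivity, min_le_left _ _, fun A hA h => ?_⟩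
  set η := min (1 / 6) (I0 / (6 * (C + 1))) with hη
  have hη0 : 0 < η := by positivity
  have hη6 : η ≤ 1 / 6 := min_le_left _ _
  have hη' : η * (6 * (C + 1)) ≤ I0 := by
    have : η ≤ I0 / (6 * (C + 1)) := min_le_right _ _
    rwa [le_div_iff₀ (by positivity)] at this
  have hpt : ∀ u : Rn d, ‖Complex.exp (-dotC d ((realIncl d + A) u) ((realIncl d + A) u)) -
      ((Real.exp (-‖u‖ ^ 2) : ℝ) : ℂ)‖ ≤
        3 * η * ((1 + ‖u‖) ^ 2 * Real.exp (-(1 / 2 * ‖u‖ ^ 2))) := by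
    intro u
    set D := dotC d ((realIncl d + A) u) ((realIncl d + A) u) with hD
    set E := D - ((‖u‖ ^ 2 : ℝ) : ℂ) with hE
    have hEn : ‖E‖ ≤ 3 * η * ‖u‖ ^ 2 := norm_dotC_sub_le hη0.le (by linarith) A hA u
    have e1 : Complex.exp (-D) - ((Real.exp (-‖u‖ ^ 2) : ℝ) : ℂ) =
        ((Real.exp (-‖u‖ ^ 2) : ℝ) : ℂ) * (Complex.exp (-E) - 1) := by
      rw [mul_sub, mul_one, Complex.ofReal_exp, ← Complex.exp_add, hE]
      congr 2
      push_cast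
      ring
    have e2 := Complex.norm_exp_sub_sum_le_norm_mul_exp (-E) 1
    simp only [Finset.range_one, Finset.sum_singleton, pow_zero, Nat.factorial_zero, Nat.cast_one,
      div_one, pow_one, norm_neg] at e2
    rw [e1, norm_mul, Complex.norm_real, Real.norm_of_nonneg (Real.exp_pos _).le]
    calc Real.exp (-‖u‖ ^ 2) * ‖Complex.exp (-E) - 1‖
        ≤ Real.exp (-‖u‖ ^ 2) * (3 * η * ‖u‖ ^ 2 * Real.exp (1 / 2 * ‖u‖ ^ 2)) := by
          gcongr
          refine e2.trans ?_
          gcongr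
          refine hEn.trans ?_
          gcongr
          linarith
      _ = 3 * η * (‖u‖ ^ 2 * Real.exp (-(1 / 2 * ‖u‖ ^ 2))) := by
          rw [show -(1 / 2 * ‖u‖ ^ 2) = -‖u‖ ^ 2 + 1 / 2 * ‖u‖ ^ 2 by ring, Real.exp_add]
          ring
      _ ≤ _ := by
          gcongr
          linarith
  have hsub : ‖(∫ u : Rn d, Complex.exp (-dotC d ((realIncl d + A) u) ((realIncl d + A) u))) -
      ∫ u : Rn d, ((Real.exp (-‖u‖ ^ 2) : ℝ) : ℂ)‖ ≤ 3 * η * C := by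
    have hm : AEStronglyMeasurable (fun u : Rn d =>
        Complex.exp (-dotC d ((realIncl d + A) u) ((realIncl d + A) u))) volume :=
      Continuous.aestronglyMeasurable (by fun_prop)
    have h_int : Integrable (fun u : Rn d =>
        Complex.exp (-dotC d ((realIncl d + A) u) ((realIncl d + A) u))) := by
      refine (integrable_mul_gauss 0).mono' hm (Filter.Eventually.of_forall fun u => ?_)
      rw [Complex.norm_exp, pow_zero, one_mul, Complex.neg_re]
      gcongr
      exact re_dotC_ge A (hA.trans hη6) u
    have hI' : Integrable (fun u : Rn d => ((Real.exp (-‖u‖ ^ 2) : ℝ) : ℂ)) := hI.ofReal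
    rw [← integral_sub h_int hI', hC, ← integral_const_mul]
    exact norm_integral_le_of_norm_le ((integrable_mul_gauss 2).const_mul _)
      (Filter.Eventually.of_forall hpt)
  rw [h, zero_sub, norm_neg, integral_complex_ofReal, Complex.norm_real,
    Real.norm_of_nonneg hI0.le] at hsub
  nlinarith

end GaussKernel

section GaussApproximation

open scoped ContDiff
open MeasureTheory

variable {P F : Type} [NormedAddCommGroup P] [NormedSpace ℝ P]
  [NormedAddCommGroup F] [NormedSpace ℝ F]

theorem exists_mean_fderiv [FiniteDimensional ℝ P] [CompleteSpace F] {a : P → F} (ha : BddDeriv a)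
    {η : ℝ} (hη : ∀ x, ‖fderiv ℝ a x‖ ≤ η) :
    ∃ A : P × P → P →L[ℝ] F, BddDeriv A ∧ (∀ p, ‖A p‖ ≤ η) ∧
      ∀ x y, a (x + y) = a x + A (x, y) y := by
  let T : ℝ → P × P →L[ℝ] P := fun θ =>
    ContinuousLinearMap.fst ℝ P P + θ • ContinuousLinearMap.snd ℝ P P
  have hT : DomBy 0 (fun (p : P × P) (θ : ℝ) => fderiv ℝ a (T θ p)) := by
    refine ha.fderiv.domBy_comp T ?_ fun θ => ?_
    · exact (contDiff_fst.comp contDiff_fst).add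
        (contDiff_snd.smul (contDiff_snd.comp contDiff_fst))
    · refine (norm_add_le _ _).trans (add_le_add (ContinuousLinearMap.norm_fst_le ..) ?_)
      rw [norm_smul]
      exact mul_le_of_le_one_right (norm_nonneg _) (ContinuousLinearMap.norm_snd_le ..)
  have h_int : ∀ p : P × P, IntervalIntegrable (fun θ => fderiv ℝ a (T θ p)) volume 0 1 := fun p =>
    (hT.1.continuous.comp (by fun_prop : Continuous fun θ : ℝ => (p, θ))).intervalIntegrable 0 1
  refine ⟨fun p => ∫ θ in Ioc (0 : ℝ) 1, fderiv ℝ a (T θ p), hT.integral fun M => ?_, fun p => ?_,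
    fun x y => ?_⟩
  · exact (Continuous.integrableOn_Icc (by simp; fun_prop)).mono_set Ioc_subset_Icc_self
  · have := norm_setIntegral_le_of_norm_le_const (μ := volume) (s := Ioc (0 : ℝ) 1)
      (f := fun θ => fderiv ℝ a (T θ p)) (C := η) (by simp) fun θ _ => hη _
    simpa using this
  · have hd : ∀ θ : ℝ, HasDerivAt (fun θ : ℝ => a (x + θ • y)) (fderiv ℝ a (T θ (x, y)) y) θ := by
      intro θ
      have h1 : HasDerivAt (fun θ : ℝ => x + θ • y) y θ := by
        simpa using ((hasDerivAt_id θ).smul_const y).const_add x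
      exact ((ha.1.differentiable (by simp)) _).hasFDerivAt.comp_hasDerivAt θ h1
    have h2 := intervalIntegral.integral_eq_sub_of_hasDerivAt (a := 0) (b := 1) (fun θ _ => hd θ)
      (((ContinuousLinearMap.apply ℝ F y).continuous.comp
        (hT.1.continuous.comp (by fun_prop : Continuous fun θ : ℝ => ((x, y), θ)))
          ).intervalIntegrable 0 1)
    have h3 : (∫ θ in Ioc (0 : ℝ) 1, fderiv ℝ a (T θ (x, y))) y =
        ∫ θ in (0 : ℝ)..1, fderiv ℝ a (T θ (x, y)) y := by
      rw [← intervalIntegral.integral_of_le zero_le_one]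
      exact ((ContinuousLinearMap.apply ℝ F y).intervalIntegral_comp_comm (h_int (x, y))).symm
    rw [h3, h2]
    simp

theorem DomBy.add {U : Type} [NormedAddCommGroup U] [NormedSpace ℝ U] {f g : P → U → F}
    {w : U → ℝ} (hf : DomBy w f) (hg : DomBy w g) : DomBy w (fun p u => f p u + g p u) := by
  refine ⟨hf.1.add hg.1, fun j => ?_⟩
  obtain ⟨C, M, hC0, hC⟩ := hf.uniform j
  obtain ⟨C', M', hC0', hC'⟩ := hg.uniform j
  refine ⟨C + C', max M M', fun p u => ?_⟩
  rw [fun_iteratedFDeriv_add_apply (((hf.contDiff u).of_le (by exact_mod_cast le_top)).contDiffAt)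
    (((hg.contDiff u).of_le (by exact_mod_cast le_top)).contDiffAt)]
  refine (norm_add_le _ _).trans ((add_le_add (hC j le_rfl p u) (hC' j le_rfl p u)).trans ?_)
  rw [add_mul, add_mul]
  have : (1 : ℝ) ≤ 1 + ‖u‖ := by simp
  gcongr
  · exact le_max_left _ _
  · exact le_max_right _ _

variable {d : ℕ}

theorem bddDeriv_gauss_integral {A : Rn d × Rn d → Rn d →L[ℝ] CE d} (hA : BddDeriv A)
    (hA6 : ∀ p, ‖A p‖ ≤ 1 / 6) {f : Rn d → ℂ} (hf : BddDeriv f) :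
    BddDeriv (fun p : Rn d × ℝ => ∫ u : Rn d, f (p.1 + p.2 • u) *
      Complex.exp (-dotC d ((realIncl d + A (p.1, p.2 • u)) u)
        ((realIncl d + A (p.1, p.2 • u)) u))) := by
  let T : Rn d → Rn d × ℝ →L[ℝ] Rn d × Rn d := fun u =>
    (ContinuousLinearMap.fst ℝ (Rn d) ℝ).prod ((ContinuousLinearMap.snd ℝ (Rn d) ℝ).smulRight u)
  have hTc : ContDiff ℝ ∞ (fun q : (Rn d × ℝ) × Rn d => T q.2 q.1) :=
    (contDiff_fst.comp contDiff_fst).prodMk ((contDiff_snd.comp contDiff_fst).smul contDiff_snd)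
  have hTn : ∀ u, ‖T u‖ ≤ 1 + ‖u‖ := by
    intro u
    refine ContinuousLinearMap.opNorm_le_bound _ (by positivity) fun p => ?_
    refine norm_prod_le_iff.2 ⟨?_, ?_⟩
    · have := norm_fst_le p
      have h0 := norm_nonneg u
      have h1 := norm_nonneg p
      change ‖p.1‖ ≤ _
      nlinarith
    · change ‖p.2 • u‖ ≤ _
      rw [norm_smul]
      have := norm_snd_le p
      have h0 := norm_nonneg u
      have h1 := norm_nonneg p
      nlinarith [mul_le_mul_of_nonneg_right this h0]
  let T' : Rn d → Rn d × ℝ →L[ℝ] Rn d := fun u =>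
    (ContinuousLinearMap.fst ℝ (Rn d) ℝ) + ((ContinuousLinearMap.snd ℝ (Rn d) ℝ).smulRight u)
  have hf' : DomBy 0 (fun (p : Rn d × ℝ) (u : Rn d) => f (T' u p)) := by
    refine hf.domBy_comp T' ?_ fun u => ?_
    · exact (contDiff_fst.comp contDiff_fst).add
        ((contDiff_snd.comp contDiff_fst).smul contDiff_snd)
    · refine (norm_add_le _ _).trans (add_le_add (ContinuousLinearMap.norm_fst_le ..) ?_)
      rw [ContinuousLinearMap.norm_smulRight_apply]
      exact mul_le_of_le_one_left (norm_nonneg _) (ContinuousLinearMap.norm_snd_le ..)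
  have hB : DomBy 0 (fun (p : Rn d × ℝ) (u : Rn d) => realIncl d + A (T u p)) :=
    (domBy_const (C := ‖realIncl d‖) (M := 0) contDiff_const fun u => by simp).add
      (hA.domBy_comp T hTc hTn)
  have hid : DomBy (P := Rn d × ℝ) 0 (fun _ (u : Rn d) => u) :=
    domBy_const (C := 1) (M := 1) contDiff_id fun u => by simp
  have hW := DomBy.bilin (ContinuousLinearMap.id ℝ (Rn d →L[ℝ] CE d)) hB hid
  have hS := DomBy.bilin (dotC d) hW hW
  simp only [Pi.zero_apply, add_zero] at hS
  have hE := DomBy.cexp (w := fun u => 1 / 2 * ‖u‖ ^ 2) hS fun p u => re_dotC_ge _ (hA6 _) u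
  have hG := DomBy.bilin (ContinuousLinearMap.mul ℝ ℂ) hf' hE
  simp only [Pi.zero_apply, zero_add] at hG
  exact hG.integral fun M => integrable_mul_gauss M

/-- Approximation by convolution with the complex Gauss kernel along a small perturbation of
`ℝ^d` in `ℂ^d`. -/
theorem exists_gauss_approx (d : ℕ) : ∃ η : ℝ, 0 < η ∧ ∀ a : Rn d → CE d, BddDeriv a →
    (∀ x, ‖fderiv ℝ a x‖ ≤ η) → ∀ c : Rn d → ℂ, ContDiff ℝ ∞ c → HasCompactSupport c →
    ∃ (H : ℝ → CE d → ℂ) (h : ℝ → Rn d → ℂ),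
      (∀ s (m : ℕ) (q : CE m →L[ℂ] CE d), PolyLim (fun z => H s (q z))) ∧ TendsC h (𝓝[>] 0) ∧
      ∀ s > 0, ∀ x, H s (realIncl d x + a x) = c x + h s x := by
  obtain ⟨η, hη0, hη6, hη⟩ := exists_integral_gauss_ne_zero d
  refine ⟨η, hη0, fun a ha hda c hc hcs => ?_⟩
  obtain ⟨A, hA, hAn, hAa⟩ := exists_mean_fderiv ha hda
  have hA6 : ∀ p, ‖A p‖ ≤ 1 / 6 := fun p => (hAn p).trans hη6
  let Φ : (Rn d → ℂ) → Rn d × ℝ → ℂ := fun f p => ∫ u : Rn d, f (p.1 + p.2 • u) *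
      Complex.exp (-dotC d ((realIncl d + A (p.1, p.2 • u)) u)
        ((realIncl d + A (p.1, p.2 • u)) u))
  have hΦ : ∀ f, BddDeriv f → BddDeriv (Φ f) := fun f hf => bddDeriv_gauss_integral hA hA6 hf
  let lam : Rn d → ℂ := fun x => Φ (fun _ => 1) (x, 0)
  have hlam0 : ∀ x, lam x ≠ 0 := fun x => by
    simpa [lam, Φ] using hη (A (x, 0)) (hAn _)
  have hlam : ContDiff ℝ ∞ lam := (hΦ _ (BddDeriv.const 1)).1.comp
    (contDiff_id.prodMk contDiff_const)
  let f : Rn d → ℂ := fun x => c x * (lam x)⁻¹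
  have hfc : ContDiff ℝ ∞ f := hc.mul (hlam.inv hlam0)
  have hfs : HasCompactSupport f := hcs.mul_right
  have hfb : BddDeriv f := hfs.bddDeriv hfc
  have hΦ0 : ∀ x, Φ f (x, 0) = c x := by
    intro x
    have : Φ f (x, 0) = f x * lam x := by
      simp only [Φ, lam, zero_smul, add_zero, one_mul]
      rw [integral_const_mul]
    rw [this, mul_assoc, inv_mul_cancel₀ (hlam0 x), mul_one]
  have hT : TendsC (fun s x => Φ f (x, s) - Φ f (x, 0)) (𝓝[>] 0) :=
    (hΦ f hfb).tendsC_sub.of_tendsto (Filter.tendsto_id.mono_left nhdsWithin_le_nhds)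
  let g : Rn d → CE d := fun y => realIncl d y + a y
  have hg : Continuous g := (realIncl d).continuous.add ha.1.continuous
  refine ⟨fun s w => ∫ y : Rn d, ((|(s ^ d)|⁻¹ : ℝ) : ℂ) * f y *
    Complex.exp (-(((s ^ 2)⁻¹ : ℝ) : ℂ) * ∑ i, (w i - g y i) ^ 2), _, fun s m q => ?_, hT,
    fun s hs x => ?_⟩
  · refine PolyLim.integral (F := fun y z => ((|(s ^ d)|⁻¹ : ℝ) : ℂ) * f y *
      Complex.exp (-(((s ^ 2)⁻¹ : ℝ) : ℂ) * ∑ i, (q z i - g y i) ^ 2)) ?_ ?_ ?_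
    · have := hfc.continuous
      fun_prop
    · exact ⟨tsupport f, hfs, fun y hy z => by simp [image_eq_zero_of_notMem_tsupport hy]⟩
    · intro y
      refine (PolyLim.const _).mul (PolyLim.exp ((PolyLim.const _).mul (PolyLim.sum _ fun i _ =>
        PolyLim.pow ?_ 2)))
      exact (PolyLim.clm ((EuclideanSpace.proj i).comp q)).add (PolyLim.const (-g y i))
  · rw [hΦ0, add_sub_cancel]
    have hgs : ∀ u, ∑ i, (g x i - g (x + s • u) i) ^ 2 =
        ((s ^ 2 : ℝ) : ℂ) * dotC d ((realIncl d + A (x, s • u)) u)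
          ((realIncl d + A (x, s • u)) u) := by
      intro u
      have h1 : g (x + s • u) = g x + s • ((realIncl d + A (x, s • u)) u) := by
        simp only [g]
        rw [hAa, map_add, map_smul, map_smul, add_apply, smul_add]
        abel
      rw [h1, dotC_apply, Finset.mul_sum]
      refine Finset.sum_congr rfl fun i _ => ?_
      simp only [PiLp.add_apply, PiLp.smul_apply, Complex.real_smul]
      push_cast
      ring
    let J : Rn d → ℂ := fun y => ((|(s ^ d)|⁻¹ : ℝ) : ℂ) * f y *
      Complex.exp (-(((s ^ 2)⁻¹ : ℝ) : ℂ) * ∑ i, (g x i - g y i) ^ 2)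
    change ∫ y, J y = _
    have e1 : ∫ y, J y = ∫ y, J (x + y) := (integral_add_left_eq_self J x).symm
    have e2 := Measure.integral_comp_smul (μ := (volume : Measure (Rn d))) (fun y => J (x + y)) s
    have hsd : (0 : ℝ) < |s ^ d| := abs_pos.2 (pow_pos hs d).ne'
    have e3 : ∫ y, J (x + y) = |s ^ d| • ∫ u, J (x + s • u) := by
      rw [e2, smul_smul, finrank_euclideanSpace_fin, abs_inv, mul_inv_cancel₀ hsd.ne', one_smul]
    rw [e1, e3, ← integral_smul]
    simp only [Φ]
    refine integral_congr_ae (Filter.Eventually.of_forall fun u => ?_)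
    simp only [J, hgs, Complex.real_smul]
    have hs2 : ((s : ℂ) ^ 2) ≠ 0 := by
      simpa using hs.ne'
    have hsd' : ((|s ^ d| : ℝ) : ℂ) ≠ 0 := by exact_mod_cast hsd.ne'
    push_cast
    rw [← mul_assoc, neg_mul, ← mul_assoc ((s : ℂ) ^ 2)⁻¹, inv_mul_cancel₀ hs2, one_mul,
      ← mul_assoc]
    rw [mul_inv_cancel₀ hsd', one_mul]

end GaussApproximation

section LocalGraphs

open scoped ContDiff

theorem exists_smooth_bump {E : Type} [NormedAddCommGroup E] [InnerProductSpace ℝ E]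
    [FiniteDimensional ℝ E] (x : E) {r : ℝ} (hr : 0 < r) :
    ∃ χ : E → ℝ, ContDiff ℝ ∞ χ ∧ HasCompactSupport χ ∧ tsupport χ ⊆ Metric.ball x r ∧
      (∀ y ∈ Metric.ball x (r / 2), χ y = 1) ∧ ∀ y, 0 ≤ χ y ∧ χ y ≤ 1 := by
  let f : ContDiffBump x := ⟨r / 2, 3 * r / 4, by positivity, by linarith⟩
  refine ⟨f, f.contDiff, f.hasCompactSupport, ?_, fun y hy => ?_, fun y => ⟨f.nonneg, f.le_one⟩⟩
  · rw [f.tsupport_eq]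
    exact Metric.closedBall_subset_ball (by change 3 * r / 4 < r; linarith)
  · exact f.one_of_mem_closedBall (Metric.ball_subset_closedBall hy)

variable {V F : Type} [NormedAddCommGroup V] [NormedSpace ℝ V] [NormedAddCommGroup F]
  [NormedSpace ℝ F]

theorem contDiff_smul_of_tsupport_subset {χ : V → ℝ} {f : V → F} {s : Set V}
    (hχ : ContDiff ℝ ∞ χ) (hs : tsupport χ ⊆ s) (hf : ∀ x ∈ s, ContDiffAt ℝ ∞ f x) :
    ContDiff ℝ ∞ (fun x => χ x • f x) := by
  refine contDiff_iff_contDiffAt.2 fun x => ?_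
  by_cases hx : x ∈ tsupport χ
  · exact hχ.contDiffAt.smul (hf x (hs hx))
  · have h : (fun x => χ x • f x) =ᶠ[𝓝 x] fun _ => 0 := by
      filter_upwards [notMem_tsupport_iff_eventuallyEq.1 hx] with y hy
      simp [hy]
    exact contDiffAt_const.congr_of_eventuallyEq h

/-- A regular level set is locally the graph over any complement of the normal directions. -/
theorem exists_local_graph [FiniteDimensional ℝ V] {c d : ℕ} {g : V → Rn c} {W : Set V} {x₀ : V}
    (hW : IsOpen W) (hx₀ : x₀ ∈ W) (hg : ContDiffOn ℝ ∞ g W) (hg₀ : g x₀ = 0)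
    (hfin : finrank ℝ V = d + c) (ρ : V →L[ℝ] Rn d)
    (hinj : ∀ v, fderiv ℝ g x₀ v = 0 → ρ v = 0 → v = 0) :
    ∃ (φ : Rn d → V) (r : ℝ) (Ω : Set V), 0 < r ∧ IsOpen Ω ∧ x₀ ∈ Ω ∧ ContDiff ℝ ∞ φ ∧
      φ (ρ x₀) = x₀ ∧ (∀ x ∈ Metric.ball (ρ x₀) r, φ x ∈ W ∧ g (φ x) = 0 ∧ ρ (φ x) = x) ∧
      ∀ z ∈ Ω, g z = 0 → φ (ρ z) = z := by
  let Ψ : V → Rn c × Rn d := fun z => (g z, ρ z)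
  have hΨ : ∀ z ∈ W, ContDiffAt ℝ ∞ Ψ z := fun z hz =>
    (hg.contDiffAt (hW.mem_nhds hz)).prodMk ρ.contDiff.contDiffAt
  have hDΨ : ∀ z ∈ W, HasFDerivAt Ψ (fderiv ℝ Ψ z) z := fun z hz =>
    ((hΨ z hz).differentiableAt (by simp)).hasFDerivAt
  have hDΨ₀ : fderiv ℝ Ψ x₀ = (fderiv ℝ g x₀).prod ρ :=
    (((hg.contDiffAt (hW.mem_nhds hx₀)).differentiableAt (by simp)).hasFDerivAt.prodMk
      ρ.hasFDerivAt).fderiv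
  have hfin' : finrank ℝ V = finrank ℝ (Rn c × Rn d) := by
    rw [hfin, finrank_prod, finrank_euclideanSpace_fin, finrank_euclideanSpace_fin, add_comm]
  have hker : LinearMap.ker (fderiv ℝ Ψ x₀).toLinearMap = ⊥ := by
    rw [LinearMap.ker_eq_bot']
    intro v hv
    rw [hDΨ₀] at hv
    exact hinj v (congrArg Prod.fst hv) (congrArg Prod.snd hv)
  let L : V ≃L[ℝ] Rn c × Rn d := (LinearEquiv.ofInjectiveOfFinrankEq (fderiv ℝ Ψ x₀).toLinearMap
    (LinearMap.ker_eq_bot.1 hker) hfin').toContinuousLinearEquiv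
  have hL : (L : V →L[ℝ] Rn c × Rn d) = fderiv ℝ Ψ x₀ := by
    ext1 v
    rfl
  have hL' : HasFDerivAt Ψ (L : V →L[ℝ] Rn c × Rn d) x₀ := hL ▸ hDΨ x₀ hx₀
  let e := (hΨ x₀ hx₀).toOpenPartialHomeomorph Ψ hL' (by simp)
  have he : ∀ z, e z = Ψ z := fun z => rfl
  have hes : x₀ ∈ e.source := (hΨ x₀ hx₀).mem_toOpenPartialHomeomorph_source hL' (by simp)
  have hcontD : ContinuousAt (fderiv ℝ Ψ) x₀ :=
    ((hΨ x₀ hx₀).fderiv_right (m := ∞) le_rfl).continuousAt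
  have hinv : ∀ᶠ z in 𝓝 x₀, fderiv ℝ Ψ z ∈ range ((↑) : (V ≃L[ℝ] Rn c × Rn d) → _) := by
    refine hcontD.eventually_mem ?_
    rw [← hL]
    exact ContinuousLinearEquiv.nhds L
  have hgood : ∀ᶠ z in 𝓝 x₀, z ∈ W ∧ z ∈ e.source ∧
      fderiv ℝ Ψ z ∈ range ((↑) : (V ≃L[ℝ] Rn c × Rn d) → _) :=
    (hW.eventually_mem hx₀).and ((e.open_source.eventually_mem hes).and hinv)
  have het : e x₀ ∈ e.target := e.map_source hes
  have hex₀ : e x₀ = (0, ρ x₀) := by rw [he]; simp [Ψ, hg₀]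
  let φ₀ : Rn d → V := fun x => e.symm (0, x)
  have hφ₀x₀ : φ₀ (ρ x₀) = x₀ := by
    change e.symm (0, ρ x₀) = x₀
    rw [← hex₀, e.left_inv hes]
  have hcont : Filter.Tendsto (fun x : Rn d => ((0 : Rn c), x)) (𝓝 (ρ x₀)) (𝓝 (0, ρ x₀)) :=
    (by fun_prop : Continuous fun x : Rn d => ((0 : Rn c), x)).tendsto _
  have hφ₀c : Filter.Tendsto φ₀ (𝓝 (ρ x₀)) (𝓝 x₀) := by
    have h1 := (e.continuousAt_symm het).tendsto
    rw [e.left_inv hes, hex₀] at h1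
    exact h1.comp hcont
  have hev : ∀ᶠ x in 𝓝 (ρ x₀), (φ₀ x ∈ W ∧ φ₀ x ∈ e.source ∧
      fderiv ℝ Ψ (φ₀ x) ∈ range ((↑) : (V ≃L[ℝ] Rn c × Rn d) → _)) ∧
      ((0 : Rn c), x) ∈ e.target :=
    (hφ₀c.eventually hgood).and (hcont.eventually (hex₀ ▸ e.open_target.mem_nhds het))
  obtain ⟨r, hr, hball⟩ := Metric.eventually_nhds_iff_ball.1 hev
  have hφ₀s : ∀ x ∈ Metric.ball (ρ x₀) r, ContDiffAt ℝ ∞ φ₀ x := by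
    intro x hx
    obtain ⟨⟨h1, h2, ⟨L', h3⟩⟩, h4⟩ := hball x hx
    have h5 : HasFDerivAt e (L' : V →L[ℝ] Rn c × Rn d) (e.symm (0, x)) := by
      rw [h3]
      exact hDΨ _ h1
    exact (e.contDiffAt_symm h4 h5 (hΨ _ h1)).comp x
      (contDiffAt_const.prodMk contDiffAt_id)
  obtain ⟨χ, hχ, -, hχs, hχ1, -⟩ := exists_smooth_bump (ρ x₀) hr
  have hφeq : ∀ x ∈ Metric.ball (ρ x₀) (r / 2), x₀ + χ x • (φ₀ x - x₀) = φ₀ x := by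
    intro x hx
    rw [hχ1 x hx, one_smul, add_sub_cancel]
  have hΩ : IsOpen (e.source ∩ ρ ⁻¹' Metric.ball (ρ x₀) (r / 2)) :=
    e.open_source.inter (Metric.isOpen_ball.preimage ρ.continuous)
  have hr2 : (0 : ℝ) < r / 2 := by positivity
  refine ⟨fun x => x₀ + χ x • (φ₀ x - x₀), r / 2, _, hr2, hΩ,
    ⟨hes, Metric.mem_ball_self hr2⟩, ?_, ?_, fun x hx => ?_, fun z hz hz0 => ?_⟩
  · exact contDiff_const.add (contDiff_smul_of_tsupport_subset hχ hχs
      fun x hx => (hφ₀s x hx).sub contDiffAt_const)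
  · change x₀ + χ (ρ x₀) • (φ₀ (ρ x₀) - x₀) = x₀
    rw [hφ₀x₀, sub_self, smul_zero, add_zero]
  · simp only [hφeq x hx]
    obtain ⟨⟨h1, -, -⟩, h4⟩ := hball x (Metric.ball_subset_ball (by linarith) hx)
    have h5 : Ψ (φ₀ x) = (0, x) := e.right_inv h4
    exact ⟨h1, congrArg Prod.fst h5, congrArg Prod.snd h5⟩
  · simp only [hφeq _ hz.2]
    change e.symm (0, ρ z) = z
    rw [show ((0 : Rn c), ρ z) = e z by rw [he]; simp [Ψ, hz0], e.left_inv hz.1]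

end LocalGraphs

section Complexification

open scoped ContDiff

variable {d m : ℕ} {E : Type} [NormedAddCommGroup E] [NormedSpace ℂ E]

/-- The real part `ℂ^d → ℝ^d`. -/
def reE (d : ℕ) : CE d →L[ℝ] Rn d :=
  LinearMap.toContinuousLinearMap
    { toFun := fun x => WithLp.toLp 2 fun i => (x i).re
      map_add' := fun x y => by ext i; simp
      map_smul' := fun c x => by ext i; simp }

@[simp] theorem reE_apply (x : CE d) (i : Fin d) : reE d x i = (x i).re := rfl

@[simp] theorem reE_realIncl (x : Rn d) : reE d (realIncl d x) = x := by
  ext i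
  simp

/-- The complexification of a real linear map on `ℝ^d`. -/
def cplx : (Rn d →L[ℝ] E) →L[ℝ] CE d →L[ℝ] E :=
  ∑ i : Fin d, ((ContinuousLinearMap.compL ℝ (CE d) ℂ E).flip
    ((EuclideanSpace.proj i : CE d →L[ℂ] ℂ).restrictScalars ℝ)) ∘L
    (ContinuousLinearMap.lsmul ℝ ℂ : ℂ →L[ℝ] E →L[ℝ] E).flip ∘L
    ContinuousLinearMap.apply ℝ E (EuclideanSpace.single i (1 : ℝ))

theorem cplx_apply (A : Rn d →L[ℝ] E) (w : CE d) :
    cplx A w = ∑ i, w i • A (EuclideanSpace.single i 1) := by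
  simp [cplx]

theorem cplx_smul (A : Rn d →L[ℝ] E) (c : ℂ) (w : CE d) : cplx A (c • w) = c • cplx A w := by
  simp [cplx_apply, Finset.smul_sum, mul_smul]

theorem cplx_realIncl (A : Rn d →L[ℝ] E) (x : Rn d) : cplx A (realIncl d x) = A x := by
  rw [cplx_apply]
  conv_rhs => rw [← (EuclideanSpace.basisFun (Fin d) ℝ).sum_repr x]
  simp

theorem eq_realIncl_add (w : CE d) :
    w = realIncl d (reE d w) + Complex.I • realIncl d (reE d (-Complex.I • w)) := by
  ext i
  apply Complex.ext <;> simp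

theorem cplx_id : cplx (realIncl d) = ContinuousLinearMap.id ℝ (CE d) := by
  ext1 w
  conv_lhs => rw [eq_realIncl_add w, map_add, cplx_smul, cplx_realIncl, cplx_realIncl]
  exact (eq_realIncl_add w).symm

theorem injective_cplx_of_isTotallyRealSub {T : Submodule ℝ (CE m)} (hT : IsTotallyRealSub T)
    {A : Rn d →L[ℝ] CE m} (hA : Function.Injective A) (hAT : ∀ x, A x ∈ T) :
    Function.Injective (cplx A) := by
  rw [injective_iff_map_eq_zero]
  intro w hw
  set x := reE d w with hx
  set y := reE d (-Complex.I • w) with hy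
  have hw' := eq_realIncl_add w
  rw [← hx, ← hy] at hw'
  rw [hw', map_add, cplx_smul, cplx_realIncl, cplx_realIncl] at hw
  have h1 : Complex.I • A y = -A x := by rw [eq_neg_iff_add_eq_zero, add_comm]; exact hw
  have h2 : Submodule.span ℂ {A y} = ⊥ := by
    refine hT _ fun v hv => ?_
    obtain ⟨c, rfl⟩ := Submodule.mem_span_singleton.1 hv
    have : c • A y = c.re • A y + c.im • (Complex.I • A y) := by
      conv_lhs => rw [← Complex.re_add_im c, add_smul, mul_smul]
      rfl
    rw [this, h1]
    exact T.add_mem (T.smul_mem _ (hAT y)) (T.smul_mem _ (T.neg_mem (hAT x)))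
  have h3 : A y = 0 := by simpa using h2
  have h4 : A x = 0 := by rw [h3, smul_zero] at h1; exact neg_eq_zero.1 h1.symm
  have h5 : y = 0 := hA (by rw [h3, map_zero])
  have h6 : x = 0 := hA (by rw [h4, map_zero])
  rw [hw', h5, h6]
  simp

theorem exists_clm_left_inverse {W : CE d →L[ℝ] CE m} (hW : Function.Injective W)
    (hI : ∀ (c : ℂ) w, W (c • w) = c • W w) : ∃ q : CE m →L[ℂ] CE d, ∀ w, q (W w) = w := by
  let W' : CE d →ₗ[ℂ] CE m := { toFun := W, map_add' := W.map_add, map_smul' := hI }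
  obtain ⟨q, hq⟩ := LinearMap.exists_leftInverse_of_injective W' (LinearMap.ker_eq_bot.2 hW)
  exact ⟨LinearMap.toContinuousLinearMap q, fun w => congrArg (fun f => f w) hq⟩

/-- A graph parametrization of a totally real submanifold `M` near `x₀`, together with a complex
linear coordinate projection `q` whose real part inverts it. -/
structure LocalChart (M : Set (CE m)) (x₀ : CE m) (d : ℕ) where
  q : CE m →L[ℂ] CE d
  φ : Rn d → CE m
  r : ℝ
  Ω : Set (CE m)
  R : Rn d → CE d →L[ℝ] CE d
  r_pos : 0 < r
  isOpen_Ω : IsOpen Ω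
  mem_Ω : x₀ ∈ Ω
  contDiff_φ : ContDiff ℝ ∞ φ
  contDiff_R : ContDiff ℝ ∞ R
  φ_base : φ (reE d (q x₀)) = x₀
  φ_mem : ∀ x ∈ Metric.ball (reE d (q x₀)) r, φ x ∈ M
  re_q_φ : ∀ x ∈ Metric.ball (reE d (q x₀)) r, reE d (q (φ x)) = x
  φ_re_q : ∀ z ∈ Ω, z ∈ M → φ (reE d (q z)) = z
  q_fderiv : ∀ v, q (fderiv ℝ φ (reE d (q x₀)) v) = realIncl d v
  R_apply : ∀ x ∈ Metric.ball (reE d (q x₀)) r, ∀ v, R x (q (fderiv ℝ φ x v)) = realIncl d v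
  R_smul : ∀ x ∈ Metric.ball (reE d (q x₀)) r, ∀ (c : ℂ) w, R x (c • w) = c • R x w

theorem IsSubmanifoldOfDim.nonempty_localChart {M : Set (CE m)} (hM : IsSubmanifoldOfDim M d)
    (htr : IsTotallyRealSet M) {x₀ : CE m} (hx₀ : x₀ ∈ M) : Nonempty (LocalChart M x₀ d) := by
  obtain ⟨W, c, g, hWo, hxW, hg, hsurj, hMW, hfin⟩ := hM x₀ hx₀
  have hg₀ : g x₀ = 0 := by
    have : x₀ ∈ M ∩ W := ⟨hx₀, hxW⟩
    rw [hMW] at this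
    exact this.2
  have hMg : ∀ z ∈ W, g z = 0 → z ∈ M := fun z h1 h2 => by
    have : z ∈ {y ∈ W | g y = 0} := ⟨h1, h2⟩
    rw [← hMW] at this
    exact this.1
  have hgM : ∀ z ∈ W, z ∈ M → g z = 0 := fun z h1 h2 => by
    have : z ∈ M ∩ W := ⟨h2, h1⟩
    rw [hMW] at this
    exact this.2
  let T : Submodule ℝ (CE m) := LinearMap.ker (fderiv ℝ g x₀).toLinearMap
  have hTmem : ∀ v, v ∈ T ↔ fderiv ℝ g x₀ v = 0 := fun v => LinearMap.mem_ker
  have hTfin : finrank ℝ (Rn d) = finrank ℝ T := by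
    have h1 := LinearMap.finrank_range_add_finrank_ker (fderiv ℝ g x₀).toLinearMap
    have h2 : LinearMap.range (fderiv ℝ g x₀).toLinearMap = ⊤ :=
      LinearMap.range_eq_top.2 (hsurj x₀ hxW)
    rw [h2, finrank_top, finrank_euclideanSpace_fin, hfin] at h1
    rw [finrank_euclideanSpace_fin]
    change d = finrank ℝ (LinearMap.ker (fderiv ℝ g x₀).toLinearMap)
    omega
  let τ : Rn d ≃ₗ[ℝ] T := LinearEquiv.ofFinrankEq _ _ hTfin
  let A : Rn d →L[ℝ] CE m := LinearMap.toContinuousLinearMap (T.subtype ∘ₗ τ.toLinearMap)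
  have hAT : ∀ x, A x ∈ T := fun x => (τ x).2
  have hAinj : Function.Injective A := fun x y h => τ.injective (Subtype.ext h)
  have hAsurj : ∀ v ∈ T, ∃ x, A x = v := fun v hv =>
    ⟨τ.symm ⟨v, hv⟩, by
      change ((τ (τ.symm ⟨v, hv⟩) : T) : CE m) = v
      rw [LinearEquiv.apply_symm_apply]⟩
  -- derivatives of local parametrizations are tangent
  have htan : ∀ (ρ : CE m →L[ℝ] Rn d) (φ : Rn d → CE m) (r : ℝ), 0 < r → ContDiff ℝ ∞ φ →
      φ (ρ x₀) = x₀ → (∀ x ∈ Metric.ball (ρ x₀) r, φ x ∈ W ∧ g (φ x) = 0 ∧ ρ (φ x) = x) →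
      ∀ v, fderiv ℝ φ (ρ x₀) v ∈ T ∧ ρ (fderiv ℝ φ (ρ x₀) v) = v := by
    intro ρ φ r hr hφ hφ0 hφr v
    have hD : HasFDerivAt φ (fderiv ℝ φ (ρ x₀)) (ρ x₀) :=
      (hφ.differentiable (by simp) _).hasFDerivAt
    have hb : ∀ᶠ x in 𝓝 (ρ x₀), x ∈ Metric.ball (ρ x₀) r := Metric.ball_mem_nhds _ hr
    have hDg : HasFDerivAt g (fderiv ℝ g x₀) (φ (ρ x₀)) := by
      rw [hφ0]
      exact ((hg.contDiffAt (hWo.mem_nhds hxW)).differentiableAt (by simp)).hasFDerivAt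
    constructor
    · have h1 : HasFDerivAt (fun _ : Rn d => (0 : Rn c))
          ((fderiv ℝ g x₀).comp (fderiv ℝ φ (ρ x₀))) (ρ x₀) :=
        (hDg.comp _ hD).congr_of_eventuallyEq (hb.mono fun x hx => (hφr x hx).2.1.symm)
      have h2 := h1.unique (hasFDerivAt_const 0 (ρ x₀))
      rw [hTmem]
      exact congrArg (fun L : Rn d →L[ℝ] Rn c => L v) h2
    · have h1 : HasFDerivAt (fun x : Rn d => x) (ρ.comp (fderiv ℝ φ (ρ x₀))) (ρ x₀) :=
        (ρ.hasFDerivAt.comp _ hD).congr_of_eventuallyEq (hb.mono fun x hx => (hφr x hx).2.2.symm)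
      have h2 := h1.unique (hasFDerivAt_id (ρ x₀))
      exact congrArg (fun L : Rn d →L[ℝ] Rn d => L v) h2
  -- the tangent space is totally real
  have hTtr : IsTotallyRealSub T := by
    obtain ⟨σ, hσ⟩ := LinearMap.exists_leftInverse_of_injective A.toLinearMap
      (LinearMap.ker_eq_bot.2 hAinj)
    let ρ : CE m →L[ℝ] Rn d := LinearMap.toContinuousLinearMap σ
    have hρ : ∀ x, ρ (A x) = x := fun x => congrArg (fun f => f x) hσ
    obtain ⟨φ, r, -, hr, -, -, hφ, hφ0, hφr, -⟩ := exists_local_graph hWo hxW hg hg₀ hfin ρ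
      fun v hv hv' => by
        obtain ⟨x, rfl⟩ := hAsurj v ((hTmem v).2 hv)
        rw [hρ] at hv'
        rw [hv', map_zero]
    have htan' := htan ρ φ r hr hφ hφ0 hφr
    intro L hL
    refine htr x₀ hx₀ L fun v hv => ?_
    obtain ⟨x, rfl⟩ := hAsurj v (hL hv)
    have h1 : fderiv ℝ φ (ρ x₀) x = A x := by
      obtain ⟨y, hy⟩ := hAsurj _ (htan' x).1
      have := (htan' x).2
      rw [← hy, hρ] at this
      rw [← hy, this]
    rw [← h1]
    refine Submodule.subset_span (tangentConeAt_mono (s := φ '' Metric.ball (ρ x₀) r) ?_ ?_)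
    · rintro _ ⟨x, hx, rfl⟩
      exact hMg _ (hφr x hx).1 (hφr x hx).2.1
    · have h2 := (hφ.differentiable (by simp) (ρ x₀)).hasFDerivAt.hasFDerivWithinAt
        (s := Metric.ball (ρ x₀) r) |>.mapsTo_tangent_cone
      rw [hφ0, tangentConeAt_of_mem_nhds (Metric.ball_mem_nhds _ hr)] at h2
      exact h2 (mem_univ x)
  obtain ⟨q, hq⟩ := exists_clm_left_inverse (injective_cplx_of_isTotallyRealSub hTtr hAinj hAT)
    (cplx_smul A)
  have hqA : ∀ x, q (A x) = realIncl d x := fun x => by rw [← cplx_realIncl A, hq]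
  let ρ : CE m →L[ℝ] Rn d := reE d ∘L q.restrictScalars ℝ
  have hρA : ∀ x, ρ (A x) = x := fun x => by
    change reE d (q (A x)) = x
    rw [hqA, reE_realIncl]
  obtain ⟨φ, r, Ω, hr, hΩ, hxΩ, hφ, hφ0, hφr, hφΩ⟩ := exists_local_graph hWo hxW hg hg₀ hfin ρ
    fun v hv hv' => by
      obtain ⟨x, rfl⟩ := hAsurj v ((hTmem v).2 hv)
      rw [hρA] at hv'
      rw [hv', map_zero]
  have hqD : ∀ v, q (fderiv ℝ φ (ρ x₀) v) = realIncl d v := by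
    intro v
    obtain ⟨h1, h2⟩ := htan ρ φ r hr hφ hφ0 hφr v
    obtain ⟨y, hy⟩ := hAsurj _ h1
    rw [← hy, hρA] at h2
    rw [← hy, hqA, h2]
  let Q : Rn d → CE d →L[ℝ] CE d := fun x => cplx ((q.restrictScalars ℝ) ∘L fderiv ℝ φ x)
  have hQ : ContDiff ℝ ∞ Q := (cplx (E := CE d)).contDiff.comp
    (((ContinuousLinearMap.compL ℝ (Rn d) (CE m) (CE d)) (q.restrictScalars ℝ)).contDiff.comp
      (hφ.fderiv_right le_rfl))
  have hQ0 : Q (ρ x₀) = 1 := by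
    have : (q.restrictScalars ℝ) ∘L fderiv ℝ φ (ρ x₀) = realIncl d := by
      ext1 v
      exact hqD v
    simp only [Q, this, cplx_id]
    rfl
  have hunit : ∀ᶠ x in 𝓝 (ρ x₀), IsUnit (Q x) := by
    refine hQ.continuous.continuousAt.eventually_mem (s := {y | IsUnit y}) ?_
    exact Units.isOpen.mem_nhds (by rw [hQ0]; exact isUnit_one)
  obtain ⟨r', hr', hball⟩ := Metric.eventually_nhds_iff_ball.1 hunit
  obtain ⟨χ, hχ, -, hχs, hχ1, -⟩ := exists_smooth_bump (ρ x₀) hr'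
  have hR : ∀ x ∈ Metric.ball (ρ x₀) (r' / 2), ∀ w,
      (χ x • Ring.inverse (Q x)) (Q x w) = w := by
    intro x hx w
    rw [hχ1 x hx, one_smul]
    have h1 := Ring.inverse_mul_cancel _ (hball x (Metric.ball_subset_ball (by linarith) hx))
    exact congrArg (fun f : CE d →L[ℝ] CE d => f w) h1
  have hsub₁ : Metric.ball (ρ x₀) (min r (r' / 2)) ⊆ Metric.ball (ρ x₀) r :=
    Metric.ball_subset_ball (min_le_left _ _)
  have hsub₂ : Metric.ball (ρ x₀) (min r (r' / 2)) ⊆ Metric.ball (ρ x₀) (r' / 2) :=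
    Metric.ball_subset_ball (min_le_right _ _)
  exact ⟨{
    q := q
    φ := φ
    r := min r (r' / 2)
    Ω := Ω ∩ W
    R := fun x => χ x • Ring.inverse (Q x)
    r_pos := by positivity
    isOpen_Ω := hΩ.inter hWo
    mem_Ω := ⟨hxΩ, hxW⟩
    contDiff_φ := hφ
    contDiff_R := contDiff_smul_of_tsupport_subset hχ hχs fun x hx =>
      (by
        obtain ⟨y, hy⟩ := hball x hx
        have := contDiffAt_ringInverse (n := ∞) ℝ y
        rw [hy] at this
        exact this.comp x hQ.contDiffAt)
    φ_base := hφ0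
    φ_mem := fun x hx => hMg _ (hφr x (hsub₁ hx)).1 (hφr x (hsub₁ hx)).2.1
    re_q_φ := fun x hx => (hφr x (hsub₁ hx)).2.2
    φ_re_q := fun z hz hzM => hφΩ z hz.1 (hgM z hz.2 hzM)
    q_fderiv := hqD
    R_apply := fun x hx v => by
      have := hR x (hsub₂ hx) (realIncl d v)
      rwa [cplx_realIncl] at this
    R_smul := fun x hx c w => by
      have h0 := hsub₂ hx
      have h1 := Ring.mul_inverse_cancel _ (hball x (Metric.ball_subset_ball (by linarith) h0))
      have h2 : Q x (Ring.inverse (Q x) w) = w := congrArg (fun f : CE d →L[ℝ] CE d => f w) h1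
      have h3 := hR x h0 (c • Ring.inverse (Q x) w)
      rw [cplx_smul, h2] at h3
      rw [h3, hχ1 x h0, one_smul] }⟩

end Complexification

section Extension

open scoped ContDiff

variable {d m : ℕ}

/-- Functions supported near the base point of a chart extend to functions on `ℂ^m` that are
small if the given functions are and have complex linear differential along `M`. -/
theorem LocalChart.exists_extension {M : Set (CE m)} {x₀ : CE m} (ch : LocalChart M x₀ d)
    {O : Set (CE m)} (hO : IsOpen O) (hxO : x₀ ∈ O) :
    ∃ (r : ℝ) (N : Set (CE m)) (ext : (Rn d → ℂ) → CE m → ℂ), 0 < r ∧ r ≤ ch.r ∧ IsOpen N ∧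
      x₀ ∈ N ∧ (∀ z ∈ N, z ∈ M → ch.φ (reE d (ch.q z)) = z) ∧
      (∀ u : Rn d → ℂ, ContDiff ℝ ∞ u → tsupport u ⊆ Metric.ball (reE d (ch.q x₀)) r →
        ContDiff ℝ ∞ (ext u) ∧ HasCompactSupport (ext u) ∧ (∀ z ∉ O, ext u z = 0) ∧
        (∀ z, z ∈ M ∨ z ∉ O → ∀ v : CE m,
          fderiv ℝ (ext u) z (Complex.I • v) = Complex.I * fderiv ℝ (ext u) z v) ∧
        ∀ z ∈ N, z ∈ M → ext u z = u (reE d (ch.q z))) ∧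
      ∀ (l : Filter ℝ) (u : ℝ → Rn d → ℂ), TendsC u l → TendsC (fun i => ext (u i)) l := by
  set ρ : CE m →L[ℝ] Rn d := reE d ∘L ch.q.restrictScalars ℝ with hρ
  have hρa : ∀ z, reE d (ch.q z) = ρ z := fun z => rfl
  simp only [hρa]
  obtain ⟨r₁, hr₁, hball⟩ := Metric.isOpen_iff.1 (ch.isOpen_Ω.inter hO) x₀ ⟨ch.mem_Ω, hxO⟩
  obtain ⟨Θ, hΘ, hΘc, hΘs, hΘ1, -⟩ := exists_smooth_bump x₀ hr₁
  have hφ0 : ch.φ (ρ x₀) = x₀ := ch.φ_base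
  have hφball : ∀ᶠ x in 𝓝 (ρ x₀), ch.φ x ∈ Metric.ball x₀ (r₁ / 2) := by
    refine ch.contDiff_φ.continuous.continuousAt.eventually_mem ?_
    rw [hφ0]
    exact Metric.ball_mem_nhds _ (by positivity)
  obtain ⟨r₂, hr₂, hφball⟩ := Metric.eventually_nhds_iff_ball.1 hφball
  let k : CE m → CE d := fun z => ch.R (ρ z) (ch.q (z - ch.φ (ρ z)))
  have hRρ : ContDiff ℝ ∞ (fun z => ch.R (ρ z)) := ch.contDiff_R.comp ρ.contDiff
  have hqφ : ContDiff ℝ ∞ (fun z => ch.q (z - ch.φ (ρ z))) :=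
    (ch.q.restrictScalars ℝ).contDiff.comp (contDiff_id.sub (ch.contDiff_φ.comp ρ.contDiff))
  have hk : ContDiff ℝ ∞ k := hRρ.clm_apply hqφ
  let a : CE m → CE d := fun z => Θ z • k z
  have ha : ContDiff ℝ ∞ a := hΘ.smul hk
  have hac : HasCompactSupport a := hΘc.smul_right
  let ext : (Rn d → ℂ) → CE m → ℂ := fun u z => Θ z • u (ρ z) + cplx (fderiv ℝ u (ρ z)) (a z)
  have hzero : ∀ u z, z ∉ tsupport Θ → ext u =ᶠ[𝓝 z] fun _ => 0 := by
    intro u z hz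
    filter_upwards [notMem_tsupport_iff_eventuallyEq.1 hz] with y hy
    simp [ext, a, hy]
  have hzΩ : ∀ z ∈ tsupport Θ, z ∈ ch.Ω ∧ z ∈ O := fun z hz => hball (hΘs hz)
  have hcplx : ∀ u : Rn d → ℂ, ContDiff ℝ ∞ u →
      ContDiff ℝ ∞ (fun y => cplx (fderiv ℝ u (ρ y))) := fun u hu =>
    (ContinuousLinearMap.contDiff (cplx (d := d) (E := ℂ))).comp
      ((hu.fderiv_right (m := ∞) le_rfl).comp ρ.contDiff)
  refine ⟨min ch.r r₂, Metric.ball x₀ (r₁ / 2), ext, lt_min ch.r_pos hr₂, min_le_left _ _,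
    Metric.isOpen_ball, Metric.mem_ball_self (by positivity), fun z hz hzM => ?_,
    fun u hu hus => ⟨?_, ?_, ?_, ?_, ?_⟩, fun l u hu => ?_⟩
  · exact ch.φ_re_q z (hball (Metric.ball_subset_ball (by linarith) hz)).1 hzM
  · exact (hΘ.smul (hu.comp ρ.contDiff)).add ((hcplx u hu).clm_apply ha)
  · refine hΘc.mono' fun z hz => ?_
    by_contra h
    exact hz (hzero u z h).self_of_nhds
  · intro z hz
    exact (hzero u z fun h => hz (hzΩ z h).2).self_of_nhds
  · intro z hz v
    by_cases hzt : z ∈ tsupport Θ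
    · by_cases hzu : ρ z ∈ tsupport u
      · have hzM : z ∈ M := hz.resolve_right fun h => h (hzΩ z hzt).2
        have hzr : ρ z ∈ Metric.ball (ρ x₀) ch.r :=
          Metric.ball_subset_ball (min_le_left _ _) (hus hzu)
        have hφz : ch.φ (ρ z) = z := ch.φ_re_q z (hzΩ z hzt).1 hzM
        have hz1 : z ∈ Metric.ball x₀ (r₁ / 2) := by
          rw [← hφz]
          exact hφball _ (Metric.ball_subset_ball (min_le_right _ _) (hus hzu))
        have heq : ext u =ᶠ[𝓝 z] fun y => u (ρ y) + cplx (fderiv ℝ u (ρ y)) (k y) := by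
          filter_upwards [Metric.isOpen_ball.mem_nhds hz1] with y hy
          simp [ext, a, hΘ1 y hy]
        have d1 : HasFDerivAt (fun y => u (ρ y)) ((fderiv ℝ u (ρ z)).comp ρ) z :=
          (hu.differentiable (by simp) _).hasFDerivAt.comp z ρ.hasFDerivAt
        have d2 : HasFDerivAt (fun y => ch.q (y - ch.φ (ρ y)))
            ((ch.q.restrictScalars ℝ).comp
              (ContinuousLinearMap.id ℝ (CE m) - (fderiv ℝ ch.φ (ρ z)).comp ρ)) z :=
          (ch.q.restrictScalars ℝ).hasFDerivAt.comp z ((hasFDerivAt_id z).sub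
            ((ch.contDiff_φ.differentiable (by simp) _).hasFDerivAt.comp z ρ.hasFDerivAt))
        have d3 := ((hRρ.differentiable (by simp)) z).hasFDerivAt.clm_apply d2
        have d4 : HasFDerivAt (fun y => cplx (fderiv ℝ u (ρ y)))
            (fderiv ℝ (fun y => cplx (fderiv ℝ u (ρ y))) z) z :=
          ((hcplx u hu).differentiable (by simp) z).hasFDerivAt
        have d5 := d1.add (d4.clm_apply d3)
        have hval : ∀ w, fderiv ℝ (ext u) z w =
            cplx (fderiv ℝ u (ρ z)) (ch.R (ρ z) (ch.q w)) := by
          intro w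
          rw [heq.fderiv_eq]
          refine (congrArg (fun L : CE m →L[ℝ] ℂ => L w) d5.fderiv).trans ?_
          simp only [hφz, sub_self, map_zero, add_apply, ContinuousLinearMap.comp_apply,
            add_zero, sub_apply,
            ContinuousLinearMap.id_apply, ContinuousLinearMap.coe_restrictScalars', map_sub,
            ch.R_apply _ hzr, cplx_realIncl]
          ring
        rw [hval, hval, map_smul, ch.R_smul _ hzr, cplx_smul, smul_eq_mul]
      · have hnear : ext u =ᶠ[𝓝 z] fun _ => 0 := by
          have h1 : ∀ᶠ y in 𝓝 (ρ z), y ∉ tsupport u :=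
            (isClosed_tsupport u).isOpen_compl.eventually_mem hzu
          filter_upwards [ρ.continuous.continuousAt.eventually h1] with y hy
          simp [ext, image_eq_zero_of_notMem_tsupport hy,
            image_eq_zero_of_notMem_tsupport fun h => hy (tsupport_fderiv_subset ℝ h)]
        rw [hnear.fderiv_eq]
        simp
    · rw [(hzero u z hzt).fderiv_eq]
      simp
  · intro z hz hzM
    have hφz : ch.φ (ρ z) = z :=
      ch.φ_re_q z (hball (Metric.ball_subset_ball (by linarith) hz)).1 hzM
    simp [ext, a, k, hΘ1 z hz, hφz]
  · have h1 := (hu.comp_clm ρ).bilin (hΘc.bddDeriv hΘ) (ContinuousLinearMap.lsmul ℝ ℝ)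
    have h2 := (hu.fderiv.comp_clm ρ).bilin (hac.bddDeriv ha) (cplx (E := ℂ)).flip
    exact h1.add h2

end Extension

section CellData

open scoped ContDiff

variable {d m : ℕ}

/-- A hyperplane direction missing a proper subspace together with a complex linear functional
that vanishes on it and separates the origin from a given ball. -/
theorem exists_separating_direction (hm : 2 ≤ m) {T : Submodule ℂ (CE m)} (hT : T ≠ ⊤) {u : CE m}
    {ρ : ℝ} (hu : ρ < ‖u‖) (hu0 : u ≠ 0) :
    ∃ e ∉ T, ∃ ℓ : CE m →L[ℂ] ℂ, ℓ e = 0 ∧ ∃ δ : ℝ, 0 < δ ∧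
      ∀ w : CE m, ‖w‖ ≤ ρ → 2 * δ ≤ (ℓ (u + w)).re := by
  have hh : ∃ h : CE m, h ≠ 0 ∧ inner ℂ h u = 0 := by
    have hne : (ℂ ∙ u)ᗮ ≠ ⊥ := by
      intro h
      have h1 := Submodule.finrank_add_finrank_orthogonal (ℂ ∙ u)
      rw [h, finrank_bot, finrank_euclideanSpace_fin, finrank_span_singleton hu0] at h1
      omega
    obtain ⟨h, hmem, h0⟩ := Submodule.exists_mem_ne_zero_of_ne_bot hne
    exact ⟨h, h0, (Submodule.mem_orthogonal_singleton_iff_inner_left.1 hmem)⟩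
  obtain ⟨h, h0, hhu⟩ := hh
  let v : CE m → CE m := fun e => ((‖e‖ ^ 2 : ℝ) : ℂ) • u - (inner ℂ e u) • e
  have hv : Continuous v := by fun_prop
  let G : Set (CE m) := {e | ‖v e‖ * ρ < (inner ℂ (v e) u).re}
  have hG : IsOpen G := by
    refine isOpen_lt (hv.norm.mul continuous_const) (Complex.continuous_re.comp ?_)
    exact hv.inner continuous_const
  have hhG : h ∈ G := by
    have h2 : 0 < ‖h‖ ^ 2 := by positivity
    have h3 : v h = ((‖h‖ ^ 2 : ℝ) : ℂ) • u := by simp [v, hhu]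
    simp only [G, mem_ofPred_eq, h3, norm_smul, inner_smul_left, Complex.conj_ofReal,
      Complex.norm_real, Real.norm_eq_abs, abs_of_pos h2, Complex.re_ofReal_mul, mul_assoc]
    refine mul_lt_mul_of_pos_left ?_ h2
    have h4 : (inner ℂ u u).re = ‖u‖ ^ 2 := by
      have := inner_self_eq_norm_sq (𝕜 := ℂ) u
      simpa using this
    rw [h4, sq]
    exact mul_lt_mul_of_pos_left hu (norm_pos_iff.2 hu0)
  obtain ⟨e, heG, heT⟩ : ∃ e ∈ G, e ∉ T := by
    by_contra! hcon
    exact hT (Submodule.eq_top_of_nonempty_interior' T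
      ⟨h, mem_interior.2 ⟨G, fun x hx => hcon x hx, hG, hhG⟩⟩)
  refine ⟨e, heT, innerSL ℂ (v e), ?_, ((inner ℂ (v e) u).re - ‖v e‖ * ρ) / 2,
    by have := heG.out; linarith, fun w hw => ?_⟩
  · simp only [innerSL_apply_apply, v, inner_sub_left, inner_smul_left, Complex.conj_ofReal,
      inner_self_eq_norm_sq_to_K, inner_conj_symm]
    push_cast
    simp only [Complex.coe_algebraMap]
    ring
  · simp only [innerSL_apply_apply, inner_add_right, Complex.add_re]
    have h1 : |(inner ℂ (v e) w).re| ≤ ‖v e‖ * ‖w‖ :=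
      (Complex.abs_re_le_norm _).trans (norm_inner_le_norm _ _)
    have h2 : ‖v e‖ * ‖w‖ ≤ ‖v e‖ * ρ := by gcongr
    have := abs_le.1 h1
    linarith

theorem exists_clm_coordinates {W : CE d →L[ℝ] CE m} (hW : Function.Injective W)
    (hI : ∀ (c : ℂ) w, W (c • w) = c • W w) {T : Submodule ℂ (CE m)} (hT : ∀ w, W w ∈ T)
    {e : CE m} (he : e ∉ T) :
    ∃ (p : CE m →L[ℂ] CE d) (l : CE m →L[ℂ] ℂ), (∀ w, p (W w) = w) ∧ p e = 0 ∧ l e = 1 := by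
  let V : CE d × ℂ →ₗ[ℂ] CE m :=
    { toFun := fun x => W x.1 + x.2 • e
      map_add' := fun x y => by simp [add_smul]; abel
      map_smul' := fun c x => by simp [hI, mul_smul] }
  have hV : ∀ x, V x = W x.1 + x.2 • e := fun _ => rfl
  have hker : LinearMap.ker V = ⊥ := by
    refine LinearMap.ker_eq_bot'.2 fun x hx => ?_
    rw [hV] at hx
    have h2 : x.2 = 0 := by
      by_contra h
      refine he ((Submodule.smul_mem_iff T h).1 ?_)
      rw [eq_neg_of_add_eq_zero_right hx]
      exact T.neg_mem (hT _)
    rw [h2, zero_smul, add_zero] at hx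
    exact Prod.ext (hW (by rw [hx]; simp)) h2
  obtain ⟨g, hg⟩ := LinearMap.exists_leftInverse_of_injective V hker
  have hgV : ∀ x, g (V x) = x := fun x => by rw [← LinearMap.comp_apply, hg]; rfl
  have hge : g e = (0, 1) := by
    have := hgV (0, 1)
    rwa [hV, map_zero, zero_add, one_smul] at this
  refine ⟨LinearMap.toContinuousLinearMap (LinearMap.fst ℂ (CE d) ℂ ∘ₗ g),
    LinearMap.toContinuousLinearMap (LinearMap.snd ℂ (CE d) ℂ ∘ₗ g), fun w => ?_, ?_, ?_⟩
  · have := hgV (w, 0)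
    rw [hV, zero_smul, add_zero] at this
    simp [this]
  · simp [hge]
  · simp [hge]

theorem exists_cutoff (d : ℕ) (F : Type) [NormedAddCommGroup F] [NormedSpace ℝ F] :
    ∃ C : ℝ, 0 < C ∧ ∀ (b : Rn d) (ρ : ℝ), 0 < ρ →
    ∃ χ : Rn d → ℝ, ContDiff ℝ ∞ χ ∧ HasCompactSupport χ ∧ tsupport χ ⊆ Metric.ball b ρ ∧
      (∀ y ∈ Metric.ball b (ρ / 2), χ y = 1) ∧ (∀ y, 0 ≤ χ y ∧ χ y ≤ 1) ∧
      ∀ (f : Rn d → F) (θ : ℝ), ContDiff ℝ ∞ f → f b = 0 →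
        (∀ x ∈ Metric.ball b ρ, ‖fderiv ℝ f x‖ ≤ θ) →
        ∀ x, ‖fderiv ℝ (fun y => χ y • f y) x‖ ≤ C * θ := by
  obtain ⟨χ, hχ, hχc, hχs, hχ1, hχ01⟩ := exists_smooth_bump (0 : Rn d) one_pos
  obtain ⟨C, hC⟩ := (hχc.bddDeriv hχ).2 1
  have hC' : ∀ x, ‖fderiv ℝ χ x‖ ≤ C := fun x => by
    simpa [norm_iteratedFDeriv_one] using hC x
  have hC0 : 0 ≤ C := (norm_nonneg _).trans (hC' 0)
  refine ⟨1 + C, by positivity, fun b ρ hρ => ?_⟩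
  let T : Rn d → Rn d := fun y => ρ⁻¹ • (y - b)
  have hT : ContDiff ℝ ∞ T := (contDiff_id.sub contDiff_const).const_smul _
  have hTd : ∀ y, HasFDerivAt T (ρ⁻¹ • ContinuousLinearMap.id ℝ (Rn d)) y := fun y =>
    ((hasFDerivAt_id y).sub_const b).const_smul ρ⁻¹
  have hTn : ∀ y, ‖T y‖ = ρ⁻¹ * dist y b := fun y => by
    rw [norm_smul, Real.norm_of_nonneg (by positivity), dist_eq_norm]
  have hsub : ∀ y, T y ∈ Metric.ball 0 1 → y ∈ Metric.ball b ρ := fun y hy => by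
    rw [mem_ball_zero_iff, hTn, inv_mul_lt_iff₀ hρ, mul_one] at hy
    exact hy
  have hts : tsupport (fun y => χ (T y)) ⊆ T ⁻¹' tsupport χ := by
    refine closure_minimal (fun y hy => subset_tsupport χ hy) ?_
    exact (isClosed_tsupport χ).preimage hT.continuous
  have hts' : tsupport (fun y => χ (T y)) ⊆ Metric.ball b ρ := fun y hy => hsub y (hχs (hts hy))
  refine ⟨fun y => χ (T y), hχ.comp hT, ?_, hts', fun y hy => hχ1 _ ?_, fun y => hχ01 _,
    fun f θ hf hfb hθ x => ?_⟩
  · exact HasCompactSupport.of_support_subset_isCompact (isCompact_closedBall b ρ)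
      ((subset_tsupport _).trans (hts'.trans Metric.ball_subset_closedBall))
  · rw [mem_ball_zero_iff, hTn, inv_mul_lt_iff₀ hρ]
    rw [Metric.mem_ball] at hy
    linarith
  · have hθ0 : 0 ≤ θ := (norm_nonneg _).trans (hθ b (Metric.mem_ball_self hρ))
    by_cases hx : x ∈ tsupport (fun y => χ (T y))
    · have hxb := hts' hx
      have h1 : HasFDerivAt (fun y => χ (T y))
          ((fderiv ℝ χ (T x)).comp (ρ⁻¹ • ContinuousLinearMap.id ℝ (Rn d))) x :=
        (hχ.differentiable (by simp) _).hasFDerivAt.comp x (hTd x)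
      have h2 : HasFDerivAt (fun y => χ (T y) • f y) _ x :=
        h1.smul (hf.differentiable (by simp) x).hasFDerivAt
      have h3 : ‖f x‖ ≤ θ * ρ := by
        have h4 := (convex_ball b ρ).norm_image_sub_le_of_norm_fderiv_le
          (fun y _ => hf.differentiable (by simp) y) hθ (Metric.mem_ball_self hρ) hxb
        rw [hfb, sub_zero] at h4
        refine h4.trans ?_
        gcongr
        rw [← dist_eq_norm]
        exact (Metric.mem_ball.1 hxb).le
      rw [show fderiv ℝ (fun y => (fun y => χ (T y)) y • f y) x = _ from h2.fderiv]
      refine ContinuousLinearMap.opNorm_le_bound _ (by positivity) fun v => ?_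
      simp only [add_apply, smul_apply, ContinuousLinearMap.smulRight_apply,
        ContinuousLinearMap.comp_apply, ContinuousLinearMap.id_apply]
      have e1 : ‖χ (T x) • fderiv ℝ f x v‖ ≤ 1 * (θ * ‖v‖) := by
        rw [norm_smul]
        gcongr
        · rw [Real.norm_of_nonneg (hχ01 _).1]
          exact (hχ01 _).2
        · exact (fderiv ℝ f x).le_of_opNorm_le (hθ x hxb) v
      have e2 : ‖fderiv ℝ χ (T x) (ρ⁻¹ • v) • f x‖ ≤ (C * (ρ⁻¹ * ‖v‖)) * (θ * ρ) := by
        rw [norm_smul]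
        gcongr
        refine ((fderiv ℝ χ (T x)).le_of_opNorm_le (hC' _) _).trans_eq ?_
        rw [norm_smul, Real.norm_of_nonneg (by positivity)]
      refine (norm_add_le _ _).trans ((add_le_add e1 e2).trans_eq ?_)
      field_simp
    · have h0 : (fun y => χ (T y) • f y) =ᶠ[𝓝 x] fun _ => 0 := by
        filter_upwards [notMem_tsupport_iff_eventuallyEq.1 hx] with y hy
        simp [hy]
      rw [h0.fderiv_eq]
      simp
      positivity

end CellData

section Admissible

open scoped ContDiff

variable {m : ℕ} {K X : Set (CE m)}

/-- Compactly supported smooth maps that vanish on `K` and have complex linear differential at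
every point of `X`. -/
structure IsAdm (K X : Set (CE m)) (s : CE m → CE m) : Prop where
  contDiff : ContDiff ℝ ∞ s
  hasCompactSupport : HasCompactSupport s
  zero_on : ∀ z ∈ K, s z = 0
  fderiv_smul : ∀ z ∈ X, ∀ v : CE m,
    fderiv ℝ s z (Complex.I • v) = Complex.I • fderiv ℝ s z v

theorem IsAdm.zero : IsAdm K X (fun _ => 0) :=
  ⟨contDiff_const, HasCompactSupport.zero, fun _ _ => rfl, fun _ _ _ => by simp⟩

theorem IsAdm.differentiable {s : CE m → CE m} (h : IsAdm K X s) : Differentiable ℝ s :=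
  h.contDiff.differentiable (by simp)

theorem IsAdm.add {s t : CE m → CE m} (hs : IsAdm K X s) (ht : IsAdm K X t) :
    IsAdm K X (fun z => s z + t z) := by
  refine ⟨hs.contDiff.add ht.contDiff, hs.hasCompactSupport.add ht.hasCompactSupport,
    fun z hz => by simp [hs.zero_on z hz, ht.zero_on z hz], fun z hz v => ?_⟩
  have h : HasFDerivAt (fun z => s z + t z) (fderiv ℝ s z + fderiv ℝ t z) z :=
    (hs.differentiable z).hasFDerivAt.add (ht.differentiable z).hasFDerivAt
  rw [h.fderiv]
  simp [hs.fderiv_smul z hz, ht.fderiv_smul z hz]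

theorem IsAdm.fderiv_csmul {s : CE m → CE m} (h : IsAdm K X s) {z : CE m} (hz : z ∈ X) (c : ℂ)
    (v : CE m) : fderiv ℝ s z (c • v) = c • fderiv ℝ s z v := by
  have h1 : ∀ w : CE m, c • w = c.re • w + c.im • Complex.I • w := fun w => by
    conv_lhs => rw [← Complex.re_add_im c, add_smul, mul_smul]
    rfl
  rw [h1, h1, map_add, map_smul, map_smul, h.fderiv_smul z hz]

theorem Csmall.norm_le {E F : Type} [NormedAddCommGroup E] [NormedSpace ℝ E]
    [NormedAddCommGroup F] [NormedSpace ℝ F] {k : ℕ} {ε : ℝ} {f : E → F} (h : Csmall k ε f)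
    (x : E) : ‖f x‖ ≤ ε := by
  simpa using h 0 (Nat.zero_le k) x

theorem Csmall.norm_fderiv_le {E F : Type} [NormedAddCommGroup E] [NormedSpace ℝ E]
    [NormedAddCommGroup F] [NormedSpace ℝ F] {k : ℕ} {ε : ℝ} {f : E → F} (h : Csmall k ε f)
    (hk : 1 ≤ k) (x : E) : ‖fderiv ℝ f x‖ ≤ ε := by
  simpa [norm_iteratedFDeriv_one] using h 1 hk x

theorem Csmall.mono {E F : Type} [NormedAddCommGroup E] [NormedSpace ℝ E]
    [NormedAddCommGroup F] [NormedSpace ℝ F] {k k' : ℕ} {ε ε' : ℝ} {f : E → F}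
    (h : Csmall k ε f) (hk : k' ≤ k) (hε : ε ≤ ε') : Csmall k' ε' f :=
  fun j hj x => (h j (hj.trans hk) x).trans hε

theorem Csmall.add {E F : Type} [NormedAddCommGroup E] [NormedSpace ℝ E]
    [NormedAddCommGroup F] [NormedSpace ℝ F] {k : ℕ} {ε ε' : ℝ} {f g : E → F}
    (hf : Csmall k ε f) (hg : Csmall k ε' g) (hfc : ContDiff ℝ ∞ f) (hgc : ContDiff ℝ ∞ g) :
    Csmall k (ε + ε') (fun x => f x + g x) := by
  intro j hj x
  rw [fun_iteratedFDeriv_add_apply (hfc.of_le (by exact_mod_cast le_top)).contDiffAt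
    (hgc.of_le (by exact_mod_cast le_top)).contDiffAt]
  exact (norm_add_le _ _).trans (add_le_add (hf j hj x) (hg j hj x))

theorem csmall_zero {E F : Type} [NormedAddCommGroup E] [NormedSpace ℝ E]
    [NormedAddCommGroup F] [NormedSpace ℝ F] (k : ℕ) {ε : ℝ} (hε : 0 ≤ ε) :
    Csmall k ε (fun _ : E => (0 : F)) := by
  intro j _ x
  rw [iteratedFDeriv_fun_zero]
  simpa using hε

end Admissible

section Cells

open scoped ContDiff

variable {d m : ℕ} {K X : Set (CE m)}

theorem exists_cell_of_coordinates (hK : IsClosed K) {x₀ : CE m} (hx₀ : x₀ ∉ K)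
    (ch : LocalChart (X \ K) x₀ d) {S₀ : CE m → CE m} (hS₀ : IsAdm K X S₀)
    {p : CE m →L[ℂ] CE d} {lm ℓ : CE m →L[ℂ] ℂ} {e : CE m} (hpe : p e = 0) (hlm : lm e = 1)
    (hℓe : ℓ e = 0)
    (hp : ∀ v, p (fderiv ℝ ch.φ (reE d (ch.q x₀)) v +
      fderiv ℝ S₀ x₀ (fderiv ℝ ch.φ (reE d (ch.q x₀)) v)) = realIncl d v)
    {L : Set (CE m)} (hL : IsCompact L) {δ : ℝ} (hδ : 0 < δ)
    (hLδ : ∀ z ∈ L, 2 * δ ≤ (ℓ (z - (x₀ + S₀ x₀))).re) :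
    ∃ N : Set (CE m), IsOpen N ∧ x₀ ∈ N ∧ ∃ ε₀ : ℝ, 0 < ε₀ ∧ ∀ S, IsAdm K X S →
      Csmall 1 ε₀ (fun z => S z - S₀ z) → ∀ (k : ℕ) (ε : ℝ), 0 < ε →
      ∃ s, IsAdm K X s ∧ Csmall k ε s ∧ ∃ Q : CE m → ℂ, PolyLim Q ∧ (∀ z ∈ L, Q z ≠ 0) ∧
        ∀ z ∈ X ∩ N, Q (z + S z + s z) = 0 := by
  obtain ⟨r, N, ext, hr, hrch, hN, hxN, hNφ, hext, hextT⟩ :=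
    ch.exists_extension hK.isOpen_compl hx₀
  obtain ⟨C, hC, hcut⟩ := exists_cutoff d (CE d)
  obtain ⟨η, hη, hgauss⟩ := exists_gauss_approx d
  set b : Rn d := reE d (ch.q x₀) with hb
  have hφb : ch.φ b = x₀ := ch.φ_base
  set θ : ℝ := η / (2 * C) with hθ
  have hθ0 : 0 < θ := by positivity
  set B : ℝ := ‖fderiv ℝ ch.φ b‖ + 1 with hB
  have hB0 : 0 < B := by positivity
  have hφd : ∀ x, HasFDerivAt ch.φ (fderiv ℝ ch.φ x) x := fun x =>
    (ch.contDiff_φ.differentiable (by simp) x).hasFDerivAt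
  let pR : CE m →L[ℝ] CE d := p.restrictScalars ℝ
  let F₀ : Rn d → CE d := fun x => pR (ch.φ x + S₀ (ch.φ x)) - realIncl d x
  have hF₀ : ContDiff ℝ ∞ F₀ :=
    (pR.contDiff.comp (ch.contDiff_φ.add (hS₀.contDiff.comp ch.contDiff_φ))).sub
      (realIncl d).contDiff
  have hF₀b : fderiv ℝ F₀ b = 0 := by
    have h1 : HasFDerivAt F₀ (pR.comp (fderiv ℝ ch.φ b +
        (fderiv ℝ S₀ (ch.φ b)).comp (fderiv ℝ ch.φ b)) - realIncl d) b :=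
      (pR.hasFDerivAt.comp b ((hφd b).add
        ((hS₀.differentiable _).hasFDerivAt.comp b (hφd b)))).sub (realIncl d).hasFDerivAt
    rw [h1.fderiv, hφb]
    ext1 v
    have h2 := hp v
    simp only [sub_apply, ContinuousLinearMap.comp_apply, add_apply, zero_apply, pR,
      ContinuousLinearMap.coe_restrictScalars']
    rw [h2, sub_self]
  have e1 : ∀ᶠ x in 𝓝 b, ‖fderiv ℝ ch.φ x‖ < B :=
    ((ch.contDiff_φ.continuous_fderiv (by simp)).norm.continuousAt).eventually_lt
      continuousAt_const (by simp [hB])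
  have e2 : ∀ᶠ x in 𝓝 b, ‖fderiv ℝ F₀ x‖ < θ :=
    ((hF₀.continuous_fderiv (by simp)).norm.continuousAt).eventually_lt
      continuousAt_const (by simpa [hF₀b] using hθ0)
  have e3 : ∀ᶠ x in 𝓝 b, (ℓ (ch.φ x + S₀ (ch.φ x) - (x₀ + S₀ x₀))).re < δ / 4 := by
    have hc : Continuous fun x => (ℓ (ch.φ x + S₀ (ch.φ x) - (x₀ + S₀ x₀))).re := by
      have h1 := ch.contDiff_φ.continuous
      have h2 := hS₀.contDiff.continuous
      fun_prop
    refine hc.continuousAt.eventually_lt continuousAt_const ?_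
    rw [hφb, sub_self, map_zero]
    simpa using hδ
  obtain ⟨ρ₁, hρ₁, hball⟩ := Metric.eventually_nhds_iff_ball.1 (e1.and (e2.and e3))
  set ρ : ℝ := min ρ₁ r with hρ
  have hρ0 : 0 < ρ := lt_min hρ₁ hr
  have hρball : ∀ x ∈ Metric.ball b ρ, _ := fun x hx =>
    hball x (Metric.ball_subset_ball (min_le_left _ _) hx)
  set ε₀ : ℝ := min (θ / ((‖pR‖ + 1) * B)) (δ / 4 / (‖ℓ‖ + 1)) with hε₀
  have hε₀0 : 0 < ε₀ := by positivity
  have hε₁ : ‖pR‖ * (ε₀ * B) ≤ θ := by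
    calc ‖pR‖ * (ε₀ * B) ≤ (‖pR‖ + 1) * (θ / ((‖pR‖ + 1) * B) * B) := by
          gcongr
          · linarith
          · exact min_le_left _ _
      _ = θ := by field_simp
  have hε₂ : ‖ℓ‖ * ε₀ ≤ δ / 4 := by
    calc ‖ℓ‖ * ε₀ ≤ (‖ℓ‖ + 1) * (δ / 4 / (‖ℓ‖ + 1)) := by
          gcongr
          · linarith
          · exact min_le_right _ _
      _ = δ / 4 := by field_simp
  obtain ⟨χ₃, hχ₃, hχ₃c, hχ₃s, hχ₃1, hχ₃01, hχ₃d⟩ := hcut b ρ hρ0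
  obtain ⟨χ, hχ, hχc, hχs, hχ1, -⟩ := exists_smooth_bump b (half_pos hρ0)
  have hqc : Continuous fun z => reE d (ch.q z) := (reE d).continuous.comp ch.q.continuous
  refine ⟨N ∩ Kᶜ ∩ (fun z => reE d (ch.q z)) ⁻¹' Metric.ball b (ρ / 2 / 2),
    (hN.inter hK.isOpen_compl).inter (Metric.isOpen_ball.preimage hqc),
    ⟨⟨hxN, hx₀⟩, Metric.mem_ball_self (by positivity)⟩, ε₀, hε₀0, fun S hS hSS k ε hε => ?_⟩
  let γ : Rn d → CE m := fun x => ch.φ x + S (ch.φ x)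
  have hγ : ContDiff ℝ ∞ γ := ch.contDiff_φ.add (hS.contDiff.comp ch.contDiff_φ)
  let c₀ : CE d := pR (x₀ + S x₀) - realIncl d b
  let F : Rn d → CE d := fun x => pR (γ x) - realIncl d x - c₀
  have hF : ContDiff ℝ ∞ F :=
    ((pR.contDiff.comp hγ).sub (realIncl d).contDiff).sub contDiff_const
  have hFb : F b = 0 := by simp [F, γ, c₀, hφb]
  have hFd : ∀ x ∈ Metric.ball b ρ, ‖fderiv ℝ F x‖ ≤ η / C := by
    intro x hx
    have hΔ : HasFDerivAt (fun z => S z - S₀ z) (fderiv ℝ (fun z => S z - S₀ z) (ch.φ x))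
        (ch.φ x) := ((hS.differentiable _).sub (hS₀.differentiable _)).hasFDerivAt
    have h1 : HasFDerivAt (fun x => F₀ x + pR (S (ch.φ x) - S₀ (ch.φ x)) - c₀)
        (fderiv ℝ F₀ x + pR.comp ((fderiv ℝ (fun z => S z - S₀ z) (ch.φ x)).comp
          (fderiv ℝ ch.φ x))) x :=
      ((hF₀.differentiable (by simp) x).hasFDerivAt.add
        (pR.hasFDerivAt.comp x (hΔ.comp x (hφd x)))).sub_const c₀
    have h2 : F = fun x => F₀ x + pR (S (ch.φ x) - S₀ (ch.φ x)) - c₀ := by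
      funext y
      simp only [F, F₀, γ, map_add, map_sub]
      abel
    rw [h2, h1.fderiv]
    have h3 : ‖pR.comp ((fderiv ℝ (fun z => S z - S₀ z) (ch.φ x)).comp (fderiv ℝ ch.φ x))‖
        ≤ ‖pR‖ * (ε₀ * B) := by
      refine (ContinuousLinearMap.opNorm_comp_le _ _).trans ?_
      gcongr
      refine (ContinuousLinearMap.opNorm_comp_le _ _).trans ?_
      gcongr
      · exact hSS.norm_fderiv_le le_rfl _
      · exact (hρball x hx).1.le
    have h4 : η / C = θ + θ := by rw [hθ]; field_simp; norm_num
    rw [h4]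
    exact (norm_add_le _ _).trans (add_le_add (hρball x hx).2.1.le (h3.trans hε₁))
  let a : Rn d → CE d := fun x => χ₃ x • F x + c₀
  have ha : BddDeriv a :=
    (HasCompactSupport.bddDeriv (f := fun x => χ₃ x • F x) (hχ₃c.smul_right)
      (hχ₃.smul hF)).add (BddDeriv.const c₀)
  have had : ∀ x, ‖fderiv ℝ a x‖ ≤ η := fun x => by
    have h1 : fderiv ℝ a x = fderiv ℝ (fun y => χ₃ y • F y) x := fderiv_add_const c₀
    rw [h1]
    refine (hχ₃d F (η / C) hF hFb hFd x).trans_eq ?_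
    field_simp
  have hag : ∀ x ∈ Metric.ball b (ρ / 2), realIncl d x + a x = p (γ x) := fun x hx => by
    simp only [a, hχ₃1 x hx, one_smul, F, pR, ContinuousLinearMap.coe_restrictScalars']
    abel
  let c : Rn d → ℂ := fun x => χ₃ x • lm (γ x)
  have hlmγ : ContDiff ℝ ∞ fun x => lm (γ x) := (lm.restrictScalars ℝ).contDiff.comp hγ
  obtain ⟨H, h, hH, hh, hHh⟩ := hgauss a ha had c (hχ₃.smul hlmγ) hχ₃c.smul_right
  set ℓ₀ : ℂ := ℓ (x₀ + S₀ x₀) + (δ : ℂ) with hℓ₀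
  let f : Rn d → ℂ := fun x => ℓ (γ x) - ℓ₀
  have hf : ContDiff ℝ ∞ f := ((ℓ.restrictScalars ℝ).contDiff.comp hγ).sub contDiff_const
  have hfre : ∀ x ∈ Metric.ball b ρ, (f x).re ≤ -(δ / 2) := by
    intro x hx
    have h1 := (hρball x hx).2.2
    have h2 : |(ℓ (S (ch.φ x) - S₀ (ch.φ x))).re| ≤ δ / 4 := by
      refine (Complex.abs_re_le_norm _).trans ((ℓ.le_opNorm _).trans (le_trans ?_ hε₂))
      gcongr
      exact hSS.norm_le _
    have h3 : f x = ℓ (ch.φ x + S₀ (ch.φ x) - (x₀ + S₀ x₀)) +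
        ℓ (S (ch.φ x) - S₀ (ch.φ x)) - (δ : ℂ) := by
      simp only [f, γ, hℓ₀, map_add, map_sub]
      ring
    rw [h3, Complex.sub_re, Complex.add_re, Complex.ofReal_re]
    have := (abs_le.1 h2).2
    linarith
  let f₁ : Rn d → ℂ := fun x => χ₃ x • (f x + ((δ / 2 : ℝ) : ℂ)) + (-((δ / 2 : ℝ) : ℂ))
  have hf₁ : BddDeriv f₁ :=
    (HasCompactSupport.bddDeriv (f := fun x => χ₃ x • (f x + ((δ / 2 : ℝ) : ℂ)))
      (hχ₃c.smul_right) (hχ₃.smul (hf.add contDiff_const))).add (BddDeriv.const _)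
  have hf₁re : ∀ x, (f₁ x).re ≤ -(δ / 2) := by
    intro x
    simp only [f₁, Complex.add_re, Complex.real_smul, Complex.re_ofReal_mul, Complex.neg_re,
      Complex.ofReal_re]
    by_cases hx : x ∈ Metric.ball b ρ
    · have h1 : χ₃ x * ((f x).re + δ / 2) ≤ 0 :=
        mul_nonpos_of_nonneg_of_nonpos (hχ₃01 x).1 (by linarith [hfre x hx])
      linarith
    · rw [image_eq_zero_of_notMem_tsupport fun h => hx (hχ₃s h)]
      simp
  have hff₁ : ∀ x ∈ Metric.ball b (ρ / 2), f₁ x = f x := fun x hx => by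
    simp [f₁, hχ₃1 x hx]
  have hexp := hf₁.tendsC_cexp (half_pos hδ) hf₁re
  have ht : ∀ s : ℝ, ∃ t : ℝ, s⁻¹ ≤ t ∧ ∀ z ∈ L, ‖lm z - H s (p z)‖ < Real.exp (t ^ 2 * δ) := by
    intro s
    have hcont : Continuous fun z => lm z - H s (p z) :=
      lm.continuous.sub (hH s m p).1
    obtain ⟨M, hM⟩ := hL.exists_bound_of_continuousOn hcont.continuousOn
    have htend : Filter.Tendsto (fun t : ℝ => Real.exp (t ^ 2 * δ)) Filter.atTop Filter.atTop :=
      Real.tendsto_exp_atTop.comp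
        ((Filter.tendsto_pow_atTop two_ne_zero).atTop_mul_const hδ)
    obtain ⟨t, ht1, ht2⟩ :=
      ((Filter.eventually_ge_atTop s⁻¹).and (htend.eventually_gt_atTop M)).exists
    exact ⟨t, ht1, fun z hz => (hM z hz).trans_lt ht2⟩
  choose t hts htL using ht
  have httend : Filter.Tendsto t (𝓝[>] 0) Filter.atTop :=
    Filter.tendsto_atTop_mono hts tendsto_inv_nhdsGT_zero
  have hexp' := hexp.of_tendsto httend
  have hχb := hχc.bddDeriv hχ
  have hχn : BddDeriv fun x => -χ x := (hχc.neg).bddDeriv hχ.neg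
  let u : ℝ → Rn d → ℂ := fun s x =>
    χ x • Complex.exp ((t s : ℂ) ^ 2 * f₁ x) + (-χ x) • h s x
  have hu : TendsC u (𝓝[>] 0) :=
    (hexp'.bilin hχb (ContinuousLinearMap.lsmul ℝ ℝ)).add
      (hh.bilin hχn (ContinuousLinearMap.lsmul ℝ ℝ))
  have hus : ∀ s, tsupport (u s) ⊆ tsupport χ := fun s => by
    refine closure_mono fun x hx => ?_
    rw [Function.mem_support] at hx ⊢
    contrapose! hx
    simp [u, hx]
  have hsub : tsupport χ ⊆ Metric.ball b r := hχs.trans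
    (Metric.ball_subset_ball (by linarith [min_le_right ρ₁ r]))
  have hmap : TendsC (fun s z => ext (u s) z • (-e)) (𝓝[>] 0) :=
    (hextT _ u hu).bilin (BddDeriv.const (-e)) (ContinuousLinearMap.lsmul ℝ ℂ).flip
  obtain ⟨s, hsε, hs0⟩ := ((hmap.csmall k hε).and self_mem_nhdsWithin).exists
  obtain ⟨hE, hEc, hE0, hEd, hEu⟩ := hext (u s) (hu.1 s) ((hus s).trans hsub)
  refine ⟨fun z => ext (u s) z • (-e), ⟨hmap.1 s, hEc.smul_right, fun z hz => ?_,
    fun z hz v => ?_⟩, hsε, fun z => lm z + (-1) * H s (p z) +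
      Complex.exp ((t s : ℂ) ^ 2 * (ℓ z + (-ℓ₀))), ?_, fun z hz hQz => ?_, fun z hz => ?_⟩
  · simp [hE0 z (not_not.2 hz)]
  · have h1 : HasFDerivAt (fun z => ext (u s) z • (-e))
        ((fderiv ℝ (ext (u s)) z).smulRight (-e)) z :=
      ((hE.differentiable (by simp) z).hasFDerivAt).smul_const (-e)
    have hz' : z ∈ X \ K ∨ z ∉ Kᶜ := by
      by_cases hzK : z ∈ K
      · exact Or.inr (not_not.2 hzK)
      · exact Or.inl ⟨hz, hzK⟩
    rw [h1.fderiv]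
    simp only [ContinuousLinearMap.smulRight_apply, hEd z hz' v, mul_smul]
  · exact ((PolyLim.clm lm).add ((PolyLim.const (-1)).mul (hH s m p))).add
      (((PolyLim.const _).mul ((PolyLim.clm ℓ).add (PolyLim.const _))).exp)
  · have h1 := htL s z hz
    have h2 : lm z - H s (p z) = -Complex.exp ((t s : ℂ) ^ 2 * (ℓ z + (-ℓ₀))) := by
      linear_combination hQz
    have h3 : δ ≤ (ℓ z + (-ℓ₀)).re := by
      have := hLδ z hz
      simp only [hℓ₀, map_sub, map_add, Complex.add_re, Complex.sub_re, Complex.neg_re,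
        Complex.ofReal_re] at this ⊢
      linarith
    rw [h2, norm_neg, Complex.norm_exp, ← Complex.ofReal_pow, Complex.re_ofReal_mul] at h1
    exact absurd (Real.exp_lt_exp.1 h1)
      (not_lt.2 (mul_le_mul_of_nonneg_left h3 (sq_nonneg _)))
  · obtain ⟨hzX, ⟨hzN, hzK⟩, hzb⟩ := hz
    have hzM : z ∈ X \ K := ⟨hzX, hzK⟩
    have hφz := hNφ z hzN hzM
    beta_reduce
    rw [hEu z hzN hzM]
    rw [mem_preimage] at hzb
    set x := reE d (ch.q z) with hx
    have hx2 : x ∈ Metric.ball b (ρ / 2) := Metric.ball_subset_ball (by linarith) hzb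
    have hγx : γ x = z + S z := by simp only [γ, hφz]
    have hux : u s x = Complex.exp ((t s : ℂ) ^ 2 * (ℓ (γ x) - ℓ₀)) - h s x := by
      simp only [u, hχ1 x hzb, hff₁ x hx2, f]
      simp
      ring
    have hHx := hHh s hs0 x
    rw [hag x hx2] at hHx
    simp only [c, hχ₃1 x hx2, one_smul] at hHx
    rw [← hγx]
    simp only [map_add, map_smul, map_neg, hpe, hℓe, hlm, neg_zero, smul_zero, add_zero,
      smul_eq_mul, hHx]
    rw [hux, sub_eq_add_neg (ℓ (γ x))]
    ring_nf

end Cells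

section CellExists

open scoped ContDiff

variable {d m : ℕ} {K X : Set (CE m)}

/-- Near a point of `X \ K` whose image avoids a given ball, small admissible perturbations push
the image into the zero set of a limit of polynomials without zeros on that ball. -/
theorem exists_cell (hK : IsClosed K) (hsub : IsSubmanifoldOfDim (X \ K) d)
    (htr : IsTotallyRealSet (X \ K)) (hd : d < m) {S₀ : CE m → CE m} (hS₀ : IsAdm K X S₀)
    {x₀ : CE m} (hx₀ : x₀ ∈ X \ K) (hS₀x : ‖fderiv ℝ S₀ x₀‖ < 1) {c : CE m} {ρ : ℝ} (hρ : 0 < ρ)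
    (hc : x₀ + S₀ x₀ ∉ Metric.closedBall c ρ) :
    ∃ N : Set (CE m), IsOpen N ∧ x₀ ∈ N ∧ ∃ ε₀ : ℝ, 0 < ε₀ ∧ ∀ S, IsAdm K X S →
      Csmall 1 ε₀ (fun z => S z - S₀ z) → ∀ (k : ℕ) (ε : ℝ), 0 < ε →
      ∃ s, IsAdm K X s ∧ Csmall k ε s ∧ ∃ Q : CE m → ℂ, PolyLim Q ∧
        (∀ z ∈ Metric.closedBall c ρ, Q z ≠ 0) ∧ ∀ z ∈ X ∩ N, Q (z + S z + s z) = 0 := by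
  obtain ⟨ch⟩ := hsub.nonempty_localChart htr hx₀
  set u : CE m := c - (x₀ + S₀ x₀) with hu
  have hρu : ρ < ‖u‖ := by
    rw [Metric.mem_closedBall, not_le, dist_comm, dist_eq_norm] at hc
    exact hc
  have hu0 : u ≠ 0 := norm_pos_iff.1 (hρ.trans hρu)
  rcases Nat.eq_zero_or_pos d with rfl | hd0
  · refine ⟨ch.Ω ∩ Kᶜ, ch.isOpen_Ω.inter hK.isOpen_compl, ⟨ch.mem_Ω, hx₀.2⟩, (‖u‖ - ρ) / 2,
      by linarith, fun S hS hSS k ε hε => ⟨fun _ => 0, IsAdm.zero, csmall_zero k hε.le,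
      fun z => innerSL ℂ u z + -(innerSL ℂ u (x₀ + S x₀)),
      (PolyLim.clm _).add (PolyLim.const _), fun z hz hQ => ?_, fun z hz => ?_⟩⟩
    · have h1 : inner ℂ u (u + ((z - c) - (S x₀ - S₀ x₀))) = 0 := by
        rw [← innerSL_apply_apply ℂ, ← hQ]
        beta_reduce
        rw [← sub_eq_add_neg, ← map_sub]
        congr 1
        rw [hu]
        abel
      rw [inner_add_right] at h1
      have h2 : (inner ℂ u u).re = ‖u‖ ^ 2 := by
        have := inner_self_eq_norm_sq (𝕜 := ℂ) u
        simpa using this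
      have h3 : |(inner ℂ u ((z - c) - (S x₀ - S₀ x₀))).re| ≤ ‖u‖ * (ρ + (‖u‖ - ρ) / 2) := by
        refine (Complex.abs_re_le_norm _).trans ((norm_inner_le_norm _ _).trans ?_)
        gcongr
        refine (norm_sub_le _ _).trans (add_le_add ?_ (hSS.norm_le x₀))
        rw [← dist_eq_norm]
        exact hz
      have h4 := congrArg Complex.re h1
      rw [Complex.add_re, h2, Complex.zero_re] at h4
      have h5 := (abs_le.1 h3).1
      nlinarith
    · obtain ⟨hzX, hzΩ, hzK⟩ := hz
      have h1 := ch.φ_re_q z hzΩ ⟨hzX, hzK⟩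
      rw [Subsingleton.elim (reE 0 (ch.q z)) (reE 0 (ch.q x₀)), ch.φ_base] at h1
      simp [h1]
  · set b := reE d (ch.q x₀) with hb
    let D : CE m →L[ℝ] CE m := ContinuousLinearMap.id ℝ (CE m) + fderiv ℝ S₀ x₀
    have hD : ∀ v, D v = v + fderiv ℝ S₀ x₀ v := fun v => rfl
    have hDI : ∀ (a : ℂ) v, D (a • v) = a • D v := fun a v => by
      rw [hD, hD, hS₀.fderiv_csmul hx₀.1, smul_add]
    have hDinj : ∀ v, D v = 0 → v = 0 := fun v hv => by
      by_contra hv0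
      have h1 : v = -fderiv ℝ S₀ x₀ v := eq_neg_of_add_eq_zero_left hv
      have h2 : ‖v‖ < ‖v‖ := by
        calc ‖v‖ = ‖fderiv ℝ S₀ x₀ v‖ := by rw [← norm_neg (fderiv ℝ S₀ x₀ v), ← h1]
          _ ≤ ‖fderiv ℝ S₀ x₀‖ * ‖v‖ := (fderiv ℝ S₀ x₀).le_opNorm v
          _ < 1 * ‖v‖ := by
            have := norm_pos_iff.2 hv0
            gcongr
          _ = ‖v‖ := one_mul _
      exact lt_irrefl _ h2
    let A : CE d →L[ℝ] CE m := cplx (fderiv ℝ ch.φ b)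
    have hqA : ∀ w, ch.q (A w) = w := fun w => by
      have h1 : cplx (realIncl d) w = w := by rw [cplx_id]; rfl
      rw [cplx_apply] at h1
      simp only [A, cplx_apply, map_sum, map_smul, hb, ch.q_fderiv]
      exact h1
    let W : CE d →L[ℝ] CE m := D.comp A
    have hWinj : Function.Injective W := (injective_iff_map_eq_zero W).2 fun w hw => by
      have h1 := hqA w
      have h2 : A w = 0 := hDinj _ hw
      rw [h2, map_zero] at h1
      exact h1.symm
    have hWI : ∀ (a : ℂ) w, W (a • w) = a • W w := fun a w => by
      simp only [W, ContinuousLinearMap.comp_apply, A, cplx_smul, hDI]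
    let Wc : CE d →ₗ[ℂ] CE m := { toFun := W, map_add' := W.map_add, map_smul' := hWI }
    have hT : LinearMap.range Wc ≠ ⊤ := fun h => by
      have h1 := Wc.finrank_range_le
      rw [h, finrank_top, finrank_euclideanSpace_fin, finrank_euclideanSpace_fin] at h1
      omega
    obtain ⟨e, heT, ℓ, hℓe, δ, hδ, hℓ⟩ :=
      exists_separating_direction (by omega) hT hρu hu0
    obtain ⟨p, lm, hp, hpe, hlm⟩ :=
      exists_clm_coordinates hWinj hWI (fun w => LinearMap.mem_range_self Wc w) heT
    refine exists_cell_of_coordinates hK hx₀.2 ch hS₀ hpe hlm hℓe (fun v => ?_)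
      (isCompact_closedBall c ρ) hδ fun z hz => ?_
    · have h1 := hp (realIncl d v)
      simpa only [W, ContinuousLinearMap.comp_apply, A, cplx_realIncl, hD] using h1
    · have h1 : z - (x₀ + S₀ x₀) = u + (z - c) := by
        rw [hu]
        abel
      rw [h1]
      exact hℓ _ (by rw [← dist_eq_norm]; exact hz)

end CellExists

section Density

open scoped ContDiff

variable {d m : ℕ} {K X : Set (CE m)}

theorem IsAdm.isBounded_image {S : CE m → CE m} (hS : IsAdm K X S) (hX : IsCompact X)
    {Y : Set (CE m)} (hY : Y ⊆ X) : Bornology.IsBounded ((fun z => z + S z) '' Y) :=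
  (hX.image (continuous_id.add hS.contDiff.continuous)).isBounded.subset (image_mono hY)

/-- The map `id + S` can be perturbed by arbitrarily small admissible maps so that polynomials
separate `L` from the image of `Y`. -/
def SepDense (K X L Y : Set (CE m)) (S : CE m → CE m) : Prop :=
  ∀ (k : ℕ) (ε : ℝ), 0 < ε → ∃ s, IsAdm K X s ∧ Csmall k ε s ∧
    PolySep L ((fun z => z + (S z + s z)) '' Y)

theorem SepDense.mono {L Y Y' : Set (CE m)} {S : CE m → CE m} (h : SepDense K X L Y S)
    (hY : Y' ⊆ Y) : SepDense K X L Y' S := by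
  intro k ε hε
  obtain ⟨s, hs, hsk, hsep⟩ := h k ε hε
  exact ⟨s, hs, hsk, hsep.mono subset_rfl (image_mono hY)⟩

theorem SepDense.union_cell (hX : IsCompact X) {L Y N : Set (CE m)} (hL : IsCompact L)
    (hY : Y ⊆ X) {S₀ S : CE m → CE m} {ε₀ : ℝ} (hε₀ : 0 < ε₀) (hS₀ : IsAdm K X S₀)
    (hcell : ∀ S, IsAdm K X S →
      Csmall 1 ε₀ (fun z => S z - S₀ z) → ∀ (k : ℕ) (ε : ℝ), 0 < ε →
      ∃ s, IsAdm K X s ∧ Csmall k ε s ∧ ∃ Q : CE m → ℂ, PolyLim Q ∧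
        (∀ z ∈ L, Q z ≠ 0) ∧ ∀ z ∈ X ∩ N, Q (z + S z + s z) = 0)
    (hS : IsAdm K X S) (hSS : Csmall 1 (ε₀ / 2) (fun z => S z - S₀ z))
    (h : SepDense K X L Y S) : SepDense K X L (Y ∪ X ∩ N) S := by
  intro k ε hε
  obtain ⟨s₁, hs₁, hs₁k, hsep⟩ := h (max k 1) (min (ε / 2) (ε₀ / 2)) (by positivity)
  have hSs := hS.add hs₁
  obtain ⟨ε', hε', hthick⟩ := hsep.exists_thickening hL (hSs.isBounded_image hX hY)
  have hnear : Csmall 1 ε₀ (fun z => (S z + s₁ z) - S₀ z) := by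
    have h1 := hSS.add (hs₁k.mono (le_max_right k 1) (min_le_right _ _))
      (hS.contDiff.sub hS₀.contDiff) hs₁.contDiff
    have h2 : (fun z => (S z + s₁ z) - S₀ z) = fun z => (S z - S₀ z) + s₁ z := by
      funext z
      abel
    rw [h2]
    exact h1.mono le_rfl (by linarith)
  obtain ⟨s₂, hs₂, hs₂k, Q, hQ, hQL, hQN⟩ :=
    hcell _ hSs hnear k (min (ε / 2) (ε' / 2)) (by positivity)
  have hs₁₂ := hs₁.add hs₂
  refine ⟨fun z => s₁ z + s₂ z, hs₁₂, ((hs₁k.mono (le_max_left k 1) (min_le_left _ _)).add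
    (hs₂k.mono le_rfl (min_le_left _ _)) hs₁.contDiff hs₂.contDiff).mono le_rfl (by linarith), ?_⟩
  have hb := hS.add hs₁₂
  rw [image_union]
  refine PolySep.union_zero (hthick.mono subset_rfl ?_) (hb.isBounded_image hX hY)
    (hb.isBounded_image hX inter_subset_left) hQ hQL ?_
  · rintro _ ⟨z, hz, rfl⟩
    refine Metric.mem_thickening_iff.2 ⟨_, mem_image_of_mem _ hz, ?_⟩
    rw [dist_eq_norm]
    have h1 : z + (S z + (s₁ z + s₂ z)) - (z + (S z + s₁ z)) = s₂ z := by abel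
    rw [h1]
    refine (hs₂k.norm_le z).trans_lt ((min_le_right _ _).trans_lt (by linarith))
  · rintro _ ⟨z, hz, rfl⟩
    have h1 := hQN z hz
    rwa [show z + (S z + s₁ z) + s₂ z = z + (S z + (s₁ z + s₂ z)) by abel] at h1

theorem sepDense_closedBall (hKX : K ⊆ X) (hK : IsCompact K) (hX : IsCompact X)
    (hKpc : IsPolyConvex K) (hsub : IsSubmanifoldOfDim (X \ K) d)
    (htr : IsTotallyRealSet (X \ K)) (hd : d < m) {S₀ : CE m → CE m} (hS₀ : IsAdm K X S₀)
    (hS₀d : ∀ x, ‖fderiv ℝ S₀ x‖ < 1) {c : CE m} {ρ : ℝ} (hρ : 0 < ρ)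
    (hc : ∀ x ∈ X, x + S₀ x ∉ Metric.closedBall c ρ) :
    SepDense K X (Metric.closedBall c ρ) X S₀ := by
  set L := Metric.closedBall c ρ with hL
  have hLc : IsCompact L := isCompact_closedBall c ρ
  have hLK : Disjoint L K := by
    refine Set.disjoint_left.2 fun z hzL hzK => hc z (hKX hzK) ?_
    rwa [hS₀.zero_on z hzK, add_zero]
  obtain ⟨ε', hε', hthick⟩ := (hKpc.sep hK hLK).exists_thickening hLc hK.isBounded
  let G : Set (CE m) := (fun z => z + S₀ z) ⁻¹' Metric.thickening ε' K
  have hG : IsOpen G :=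
    Metric.isOpen_thickening.preimage (continuous_id.add hS₀.contDiff.continuous)
  have hKG : K ⊆ G := fun z hz => by
    simp only [G, mem_preimage, hS₀.zero_on z hz, add_zero]
    exact Metric.self_subset_thickening hε' K hz
  have hstart : SepDense K X L (X ∩ G) S₀ := fun k ε hε =>
    ⟨fun _ => 0, IsAdm.zero, csmall_zero k hε.le, hthick.mono subset_rfl (by
      rintro _ ⟨z, hz, rfl⟩
      have h1 : z + S₀ z ∈ Metric.thickening ε' K := hz.2
      simpa using h1)⟩
  have key : ∃ ε₀ : ℝ, 0 < ε₀ ∧ ∀ S Y, Y ⊆ X → IsAdm K X S →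
      Csmall 1 ε₀ (fun z => S z - S₀ z) → SepDense K X L Y S →
      SepDense K X L (Y ∪ X ∩ (X \ G)) S := by
    refine (hX.diff hG).induction_on (p := fun Z => ∃ ε₀ : ℝ, 0 < ε₀ ∧ ∀ S Y, Y ⊆ X → IsAdm K X S →
      Csmall 1 ε₀ (fun z => S z - S₀ z) → SepDense K X L Y S →
      SepDense K X L (Y ∪ X ∩ Z) S) ?_ ?_ ?_ ?_
    · refine ⟨1, one_pos, fun S Y _ _ _ h => ?_⟩
      simpa using h
    · rintro Z Z' hZ ⟨ε₀, hε₀, h⟩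
      exact ⟨ε₀, hε₀, fun S Y hY hS hSS hsep => (h S Y hY hS hSS hsep).mono
        (union_subset_union_right _ (inter_subset_inter_right _ hZ))⟩
    · rintro Z Z' ⟨ε₀, hε₀, h⟩ ⟨ε₁, hε₁, h'⟩
      refine ⟨min ε₀ ε₁, lt_min hε₀ hε₁, fun S Y hY hS hSS hsep => ?_⟩
      have h1 := h S Y hY hS (hSS.mono le_rfl (min_le_left _ _)) hsep
      have h2 := h' S _ (union_subset hY inter_subset_left) hS
        (hSS.mono le_rfl (min_le_right _ _)) h1
      rwa [inter_union_distrib_left, ← union_assoc]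
    · rintro x ⟨hxX, hxG⟩
      obtain ⟨N, hN, hxN, ε₀, hε₀, hcell⟩ := exists_cell hK.isClosed hsub htr hd hS₀
        ⟨hxX, fun h => hxG (hKG h)⟩ (hS₀d x) hρ (hc x hxX)
      exact ⟨N, mem_nhdsWithin_of_mem_nhds (hN.mem_nhds hxN), ε₀ / 2, half_pos hε₀,
        fun S Y hY hS hSS hsep => hsep.union_cell hX hLc hY hε₀ hS₀ hcell hS hSS⟩
  obtain ⟨ε₀, hε₀, h⟩ := key
  refine (h S₀ (X ∩ G) inter_subset_left hS₀ ?_ hstart).mono fun z hz => ?_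
  · simpa using csmall_zero 1 hε₀.le
  · by_cases hzG : z ∈ G
    · exact Or.inl ⟨hz, hzG⟩
    · exact Or.inr ⟨hz, hz, hzG⟩

end Density

section Diffeomorphism

open scoped ContDiff

variable {E : Type} [NormedAddCommGroup E] [NormedSpace ℝ E] [FiniteDimensional ℝ E]

theorem exists_contDiff_inverse_id_add {S : E → E} (hS : ContDiff ℝ ∞ S)
    (hSd : ∀ x, ‖fderiv ℝ S x‖ ≤ 1 / 2) :
    ∃ g : E → E, ContDiff ℝ ∞ g ∧ Function.LeftInverse g (fun x => x + S x) ∧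
      Function.RightInverse g (fun x => x + S x) := by
  have hdiff : Differentiable ℝ S := hS.differentiable (by simp)
  have happ : ApproximatesLinearOn (fun x => x + S x)
      ((ContinuousLinearEquiv.refl ℝ E : E ≃L[ℝ] E) : E →L[ℝ] E) univ (1 / 2) := by
    intro x _ y _
    have h1 := convex_univ.norm_image_sub_le_of_norm_fderiv_le (f := S) (𝕜 := ℝ)
      (fun z _ => hdiff z) (fun z _ => hSd z) (mem_univ y) (mem_univ x)
    refine le_trans (le_of_eq ?_) (h1.trans_eq (by norm_num))
    congr 1
    simp
    abel
  have hlt : Subsingleton E ∨ (1 / 2 : NNReal) <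
      ‖((ContinuousLinearEquiv.refl ℝ E).symm : E →L[ℝ] E)‖₊⁻¹ := by
    rcases subsingleton_or_nontrivial E with h | h
    · exact Or.inl h
    · right
      have h1 : ‖((ContinuousLinearEquiv.refl ℝ E).symm : E →L[ℝ] E)‖₊ = 1 := by
        ext
        exact ContinuousLinearMap.norm_id
      rw [h1, inv_one]
      exact NNReal.half_lt_self one_ne_zero
  let e : E ≃ₜ E := happ.toHomeomorph _ hlt
  have he : ∀ x, e x = x + S x := fun x => rfl
  have hD : ∀ a, Function.Injective
      ((ContinuousLinearMap.id ℝ E + fderiv ℝ S a : E →L[ℝ] E) : E →ₗ[ℝ] E) := fun a =>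
    (injective_iff_map_eq_zero _).2 fun v hv => by
      have h1 : v = -fderiv ℝ S a v := eq_neg_of_add_eq_zero_left hv
      have h2 : ‖v‖ ≤ 1 / 2 * ‖v‖ := by
        calc ‖v‖ = ‖fderiv ℝ S a v‖ := by rw [← norm_neg (fderiv ℝ S a v), ← h1]
          _ ≤ 1 / 2 * ‖v‖ := (fderiv ℝ S a).le_of_opNorm_le (hSd a) v
      exact norm_eq_zero.1 (by linarith [norm_nonneg v])
  refine ⟨e.symm, e.contDiff_symm
    (f₀' := fun a => (LinearEquiv.ofInjectiveEndo _ (hD a)).toContinuousLinearEquiv)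
    (fun a => ?_) (contDiff_id.add hS), fun x => e.symm_apply_apply x,
    fun x => e.apply_symm_apply x⟩
  have h1 : HasFDerivAt (fun x => x + S x) (ContinuousLinearMap.id ℝ E + fderiv ℝ S a) a :=
    (hasFDerivAt_id a).add (hdiff a).hasFDerivAt
  exact h1

end Diffeomorphism

section Sequence

open scoped ContDiff

variable {d m : ℕ} {K X : Set (CE m)}

/-- A sequence of admissible maps with rapidly decreasing increments such that, whenever the image
of `X` under `id + S n` avoids the `n`-th ball, polynomials separate that ball from a neighbourhood
of the image under the next map. -/
theorem exists_isAdm_seq (hKX : K ⊆ X) (hK : IsCompact K) (hX : IsCompact X)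
    (hKpc : IsPolyConvex K) (hsub : IsSubmanifoldOfDim (X \ K) d)
    (htr : IsTotallyRealSet (X \ K)) (hd : d < m) (c : ℕ → CE m) (ρ : ℕ → ℝ) (hρ : ∀ n, 0 < ρ n)
    (k : ℕ) {η₀ : ℝ} (hη₀ : 0 < η₀) (hη₀' : η₀ ≤ 1 / 2) :
    ∃ (S : ℕ → CE m → CE m) (η : ℕ → ℝ), S 0 = (fun _ => 0) ∧ η 0 = η₀ ∧
      (∀ n, IsAdm K X (S n)) ∧ (∀ n, 0 < η n) ∧ (∀ n, η (n + 1) ≤ η n / 2) ∧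
      (∀ n, Csmall (k + 1 + n) (η n / 2) (fun z => S (n + 1) z - S n z)) ∧
      (∀ n, (∀ x ∈ X, x + S n x ∉ Metric.closedBall (c n) (ρ n)) →
        PolySep (Metric.closedBall (c n) (ρ n))
          (Metric.thickening (2 * η (n + 1)) ((fun z => z + S (n + 1) z) '' X))) := by
  let St := {p : (CE m → CE m) × ℝ //
    IsAdm K X p.1 ∧ 0 < p.2 ∧ ∀ x, ‖fderiv ℝ p.1 x‖ ≤ 1 / 2 - p.2}
  have step : ∀ (n : ℕ) (p : St), ∃ p' : St, p'.1.2 ≤ p.1.2 / 2 ∧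
      Csmall (k + 1 + n) (p.1.2 / 2) (fun z => p'.1.1 z - p.1.1 z) ∧
      ((∀ x ∈ X, x + p.1.1 x ∉ Metric.closedBall (c n) (ρ n)) →
        PolySep (Metric.closedBall (c n) (ρ n))
          (Metric.thickening (2 * p'.1.2) ((fun z => z + p'.1.1 z) '' X))) := by
    rintro n ⟨⟨S, η⟩, hS, hη, hSd⟩
    dsimp only at hS hη hSd ⊢
    by_cases hc : ∀ x ∈ X, x + S x ∉ Metric.closedBall (c n) (ρ n)
    · obtain ⟨s, hs, hsk, hsep⟩ := sepDense_closedBall hKX hK hX hKpc hsub htr hd hS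
        (fun x => (hSd x).trans_lt (by linarith)) (hρ n) hc (k + 1 + n) (η / 2) (half_pos hη)
      have hSs := hS.add hs
      obtain ⟨ε', hε', hthick⟩ :=
        hsep.exists_thickening (isCompact_closedBall _ _) (hSs.isBounded_image hX subset_rfl)
      have hle : 2 * min (η / 2) (ε' / 2) ≤ ε' := by linarith [min_le_right (η / 2) (ε' / 2)]
      refine ⟨⟨⟨fun z => S z + s z, min (η / 2) (ε' / 2)⟩, hSs, by positivity, fun x => ?_⟩,
        min_le_left _ _, ?_, fun _ => hthick.mono subset_rfl
          (Metric.thickening_mono hle _)⟩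
      · have h1 : HasFDerivAt (fun z => S z + s z) (fderiv ℝ S x + fderiv ℝ s x) x :=
          (hS.differentiable x).hasFDerivAt.add (hs.differentiable x).hasFDerivAt
        have h2 := hsk.norm_fderiv_le (by omega) x
        have h3 := hSd x
        have h4 := norm_add_le (fderiv ℝ S x) (fderiv ℝ s x)
        rw [h1.fderiv]
        linarith [min_le_left (η / 2) (ε' / 2)]
      · simpa using hsk
    · refine ⟨⟨⟨S, η / 2⟩, hS, half_pos hη, fun x => (hSd x).trans (by linarith)⟩, le_rfl, ?_,
        fun h => absurd h hc⟩
      simpa using csmall_zero _ (half_pos hη).le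
  choose f hf1 hf2 hf3 using step
  let p₀ : St := ⟨⟨fun _ => 0, η₀⟩, IsAdm.zero, hη₀, fun x => by simpa using hη₀'⟩
  let p : ℕ → St := fun n => Nat.rec p₀ f n
  exact ⟨fun n => (p n).1.1, fun n => (p n).1.2, rfl, rfl, fun n => (p n).2.1,
    fun n => (p n).2.2.1, fun n => hf1 n (p n), fun n => hf2 n (p n), fun n => hf3 n (p n)⟩

end Sequence

section Limit

open scoped ContDiff

variable {m : ℕ} {K X : Set (CE m)}

theorem exists_tendsto_of_csmall {S : ℕ → CE m → CE m} {η : ℕ → ℝ} {k : ℕ}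
    (hS0 : S 0 = fun _ => 0) (hS : ∀ n, IsAdm K X (S n)) (hη : ∀ n, η (n + 1) ≤ η n / 2)
    (hSk : ∀ n, Csmall (k + 1 + n) (η n / 2) (fun z => S (n + 1) z - S n z)) :
    ∃ T : CE m → CE m, ContDiff ℝ ∞ T ∧ Csmall (k + 1) (η 0) T ∧ (∀ z ∈ K, T z = 0) ∧
      (∀ z ∈ X, ∀ v : CE m, fderiv ℝ T z (Complex.I • v) = Complex.I • fderiv ℝ T z v) ∧
      ∀ n z, ‖S n z - T z‖ ≤ η n := by
  have hηn : ∀ n i, η (n + i) ≤ η n / 2 ^ i := by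
    intro n i
    induction i with
    | zero => simp
    | succ i ih =>
      refine (hη (n + i)).trans ((div_le_div_of_nonneg_right ih two_pos.le).trans_eq ?_)
      rw [pow_succ, div_div]
  have hη' : ∀ i, η i / 2 ≤ η 0 / 2 / 2 ^ i := fun i => by
    have h1 := hηn 0 i
    rw [zero_add] at h1
    refine (div_le_div_of_nonneg_right h1 two_pos.le).trans_eq ?_
    ring
  let s : ℕ → CE m → CE m := fun n z => S (n + 1) z - S n z
  have hs : ∀ n, ContDiff ℝ ∞ (s n) := fun n => (hS (n + 1)).contDiff.sub (hS n).contDiff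
  have hsb : ∀ (j n : ℕ) z, j ≤ k + 1 → ‖iteratedFDeriv ℝ j (s n) z‖ ≤ η 0 / 2 / 2 ^ n :=
    fun j n z hj => (hSk n j (by omega) z).trans (hη' n)
  have hsum := summable_geometric_two' (η 0)
  let T : CE m → CE m := fun z => ∑' n, s n z
  have hpartial : ∀ n z, ∑ i ∈ Finset.range n, s i z = S n z := fun n z => by
    simp only [s, Finset.sum_range_sub (fun i => S i z), hS0, sub_zero]
  have hsz : ∀ z, Summable fun n => s n z := fun z =>
    Summable.of_norm_bounded hsum fun n => by simpa using hsb 0 n z (Nat.zero_le _)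
  have htend : ∀ z, Filter.Tendsto (fun n => S n z) Filter.atTop (𝓝 (T z)) := fun z => by
    have h1 := (hsz z).hasSum.tendsto_sum_nat
    simpa only [hpartial] using h1
  refine ⟨T, ?_, fun j hj z => ?_, fun z hz => ?_, fun z hz v => ?_, fun n z => ?_⟩
  · refine contDiff_tsum_of_eventually (N := ⊤) (v := fun _ n => η 0 / 2 / 2 ^ n) hs
      (fun _ _ => hsum) fun j _ => ?_
    rw [Nat.cofinite_eq_atTop]
    filter_upwards [Filter.eventually_ge_atTop j] with n hn z
    exact (hSk n j (by omega) z).trans (hη' n)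
  · have h1 := iteratedFDeriv_tsum_apply (𝕜 := ℝ) (N := ((k + 1 : ℕ) : ℕ∞)) (f := s)
      (v := fun _ n => η 0 / 2 / 2 ^ n) (fun i => (hs i).of_le (by exact_mod_cast le_top))
      (fun _ _ => hsum) (fun j n z hj => hsb j n z (by exact_mod_cast hj))
      (k := j) (by exact_mod_cast hj) z
    rw [h1]
    exact tsum_of_norm_bounded (hasSum_geometric_two' (η 0)) fun n => hsb j n z hj
  · refine tendsto_nhds_unique (htend z) ?_
    simp only [(hS _).zero_on z hz]
    exact tendsto_const_nhds
  · have hd1 : ∀ n x, ‖fderiv ℝ (s n) x‖ ≤ η 0 / 2 / 2 ^ n := fun n x => by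
      simpa [norm_iteratedFDeriv_one] using hsb 1 n x (by omega)
    have h1 : HasFDerivAt T (∑' n, fderiv ℝ (s n) z) z :=
      hasFDerivAt_tsum hsum (fun n x => ((hs n).differentiable (by simp) x).hasFDerivAt) hd1
        (hsz z) z
    have h2 : HasSum (fun n => fderiv ℝ (s n) z) (∑' n, fderiv ℝ (s n) z) :=
      (Summable.of_norm_bounded hsum fun n => hd1 n z).hasSum
    have h3 : ∀ w, HasSum (fun n => fderiv ℝ (s n) z w) ((∑' n, fderiv ℝ (s n) z) w) := fun w =>
      h2.mapL (ContinuousLinearMap.apply ℝ (CE m) w)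
    rw [h1.fderiv]
    refine (h3 (Complex.I • v)).unique ?_
    have h4 : ∀ n, fderiv ℝ (s n) z (Complex.I • v) = Complex.I • fderiv ℝ (s n) z v := fun n => by
      have h5 : HasFDerivAt (s n) (fderiv ℝ (S (n + 1)) z - fderiv ℝ (S n) z) z :=
        ((hS (n + 1)).differentiable z).hasFDerivAt.sub ((hS n).differentiable z).hasFDerivAt
      rw [h5.fderiv, sub_apply, sub_apply, (hS _).fderiv_smul z hz, (hS _).fderiv_smul z hz,
        smul_sub]
    simp only [h4]
    exact (h3 v).const_smul Complex.I
  · rw [← dist_eq_norm]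
    refine dist_le_of_le_geometric_two_of_tendsto₀ (f := fun i => S (n + i) z)
      (C := η n) (fun i => ?_) ?_
    · rw [dist_comm, dist_eq_norm]
      refine ((hSk (n + i)).norm_le z).trans ?_
      refine (div_le_div_of_nonneg_right (hηn n i) two_pos.le).trans_eq ?_
      ring
    · simpa only [add_comm n] using (Filter.tendsto_add_atTop_iff_nat n).2 (htend z)

/-- Every small enough neighbourhood of a point `w` contains a ball of the list
`c n = denseSeq`, `ρ n = 1 / (b + 1)` around `w`, with arbitrarily large index. -/
theorem exists_closedBall_subset_ball (w : CE m) {r : ℝ} (hr : 0 < r) (N : ℕ) :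
    ∃ n, N ≤ n ∧
      w ∈ Metric.closedBall (TopologicalSpace.denseSeq (CE m) n.unpair.1.unpair.1)
        (1 / ((n.unpair.1.unpair.2 : ℝ) + 1)) ∧
      Metric.closedBall (TopologicalSpace.denseSeq (CE m) n.unpair.1.unpair.1)
        (1 / ((n.unpair.1.unpair.2 : ℝ) + 1)) ⊆ Metric.ball w r := by
  obtain ⟨b, hb⟩ := exists_nat_one_div_lt (half_pos hr)
  have hb0 : (0 : ℝ) < 1 / ((b : ℝ) + 1) := Nat.one_div_pos_of_nat
  obtain ⟨a, ha⟩ := (TopologicalSpace.denseRange_denseSeq (CE m)).exists_dist_lt w hb0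
  refine ⟨Nat.pair (Nat.pair a b) N, Nat.right_le_pair _ _, ?_, ?_⟩
  · simpa only [Nat.unpair_pair] using Metric.mem_closedBall.2 ha.le
  · simp only [Nat.unpair_pair]
    refine Metric.closedBall_subset_ball' ?_
    rw [dist_comm]
    linarith

theorem isPolyConvex_image_id_add {S : ℕ → CE m → CE m} {T : CE m → CE m} {η : ℕ → ℝ}
    (hX : IsCompact X) (hT : Continuous T) (hη : ∀ n, η (n + 1) ≤ η n / 2) (hη0 : ∀ n, 0 < η n)
    (hST : ∀ n z, ‖S n z - T z‖ ≤ η n) {c : ℕ → CE m} {ρ : ℕ → ℝ}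
    (hc : ∀ (w : CE m) (r : ℝ), 0 < r → ∀ N, ∃ n, N ≤ n ∧ w ∈ Metric.closedBall (c n) (ρ n) ∧
      Metric.closedBall (c n) (ρ n) ⊆ Metric.ball w r)
    (hsep : ∀ n, (∀ x ∈ X, x + S n x ∉ Metric.closedBall (c n) (ρ n)) →
      PolySep (Metric.closedBall (c n) (ρ n))
        (Metric.thickening (2 * η (n + 1)) ((fun z => z + S (n + 1) z) '' X))) :
    IsPolyConvex ((fun z => z + T z) '' X) := by
  have hanti : Antitone η := antitone_nat_of_succ_le fun n =>
    (hη n).trans (half_le_self (hη0 n).le)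
  have hle : ∀ n, η n ≤ η 0 * (1 / 2) ^ n := fun n => by
    induction n with
    | zero => simp
    | succ n ih =>
      rw [pow_succ]
      linarith [hη n]
  have hlim : Filter.Tendsto η Filter.atTop (𝓝 0) := by
    refine squeeze_zero (fun n => (hη0 n).le) hle ?_
    simpa using (tendsto_pow_atTop_nhds_zero_of_lt_one (r := (1 / 2 : ℝ)) (by norm_num)
      (by norm_num)).const_mul (η 0)
  refine IsPolyConvex.of_sep fun w hw => ?_
  have hcl : IsClosed ((fun z => z + T z) '' X) := (hX.image (continuous_id.add hT)).isClosed
  obtain ⟨r, hr, hrX⟩ := Metric.isOpen_iff.1 hcl.isOpen_compl w hw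
  obtain ⟨N, hN⟩ := (hlim.eventually_lt_const (half_pos hr)).exists
  obtain ⟨n, hn, hwn, hsubn⟩ := hc w (r / 2) (half_pos hr) N
  refine (hsep n fun x hx hxn => hrX ?_ ⟨x, hx, rfl⟩).mono le_rfl ?_ w hwn
  · have h1 := Metric.mem_ball.1 (hsubn hxn)
    have h2 : dist (x + T x) (x + S n x) ≤ η n := by
      rw [dist_add_left, dist_comm, dist_eq_norm]
      exact hST n x
    have h3 := dist_triangle (x + T x) (x + S n x) w
    exact Metric.mem_ball.2 (by linarith [hanti hn])
  · rintro _ ⟨x, hx, rfl⟩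
    refine Metric.mem_thickening_iff.2 ⟨_, ⟨x, hx, rfl⟩, ?_⟩
    have h2 : dist (x + T x) (x + S (n + 1) x) ≤ η (n + 1) := by
      rw [dist_add_left, dist_comm, dist_eq_norm]
      exact hST _ x
    exact h2.trans_lt (by linarith [hη0 (n + 1)])

end Limit

/-- Theorem 4.1, the perturbation theorem of [AW], [ASKW].
Let `K ⊆ X ⊆ ℂᵐ` be compact, `K` polynomially convex, `X \ K` a totally real smooth
submanifold of dimension `d < m`. Then for every `k` and every neighborhood of the
identity in the (weak) `C^k`-topology — i.e. for every compact set `K'` and `ε > 0` —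
there is a smooth diffeomorphism `ψ` of ℂᵐ, `C^k`-`ε`-close to the identity on `K'`,
fixing `K` pointwise, with ℂ-linear differential at every point of `X`, and such that
`ψ(X)` is polynomially convex. -/
theorem perturbation_polynomially_convex (m : ℕ) (K X : Set (CE m)) (d : ℕ)
    (hKX : K ⊆ X) (hK : IsCompact K) (hX : IsCompact X)
    (hKpc : IsPolyConvex K)
    (hsub : IsSubmanifoldOfDim (X \ K) d)
    (htr : IsTotallyRealSet (X \ K))
    (hd : d < m) :
    ∀ (k : ℕ) (K' : Set (CE m)), IsCompact K' → ∀ ε : ℝ, 0 < ε →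
      ∃ ψ : CE m → CE m, ∃ ψinv : CE m → CE m,
        ContDiff ℝ (⊤ : ℕ∞) ψ ∧ ContDiff ℝ (⊤ : ℕ∞) ψinv ∧
        Function.LeftInverse ψinv ψ ∧ Function.RightInverse ψinv ψ ∧
        (∀ j ≤ k, ∀ z ∈ K', ‖iteratedFDeriv ℝ j (fun w => ψ w - w) z‖ < ε) ∧
        (∀ z ∈ K, ψ z = z) ∧
        (∀ z ∈ X, ∀ v : CE m, fderiv ℝ ψ z (Complex.I • v) = Complex.I • fderiv ℝ ψ z v) ∧
        IsPolyConvex (ψ '' X) := by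
  intro k K' _ ε hε
  obtain ⟨S, η, hS0, hη₀, hS, hη0, hη, hSk, hsep⟩ :=
    exists_isAdm_seq hKX hK hX hKpc hsub htr hd
      (fun n => TopologicalSpace.denseSeq (CE m) n.unpair.1.unpair.1)
      (fun n => 1 / ((n.unpair.1.unpair.2 : ℝ) + 1)) (fun _ => Nat.one_div_pos_of_nat) k
      (η₀ := min (1 / 2) (ε / 2)) (lt_min one_half_pos (half_pos hε)) (min_le_left _ _)
  obtain ⟨T, hT, hTk, hTK, hTX, hST⟩ := exists_tendsto_of_csmall hS0 hS hη hSk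
  rw [hη₀] at hTk
  obtain ⟨g, hg, hgl, hgr⟩ := exists_contDiff_inverse_id_add hT fun x =>
    (hTk.norm_fderiv_le (Nat.le_add_left 1 k) x).trans (min_le_left _ _)
  refine ⟨fun z => z + T z, g, contDiff_id.add hT, hg, hgl, hgr, fun j hj z _ => ?_,
    fun z hz => ?_, fun z hz v => ?_, ?_⟩
  · simp only [add_sub_cancel_left]
    refine (hTk j (hj.trans (Nat.le_succ k)) z).trans_lt ?_
    exact (min_le_right _ _).trans_lt (half_lt_self hε)
  · simp only [hTK z hz, add_zero]
  · have h1 : HasFDerivAt (fun z => z + T z) (ContinuousLinearMap.id ℝ (CE m) + fderiv ℝ T z) z :=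
      (hasFDerivAt_id z).add (hT.differentiable (by simp) z).hasFDerivAt
    rw [h1.fderiv]
    simp only [add_apply, ContinuousLinearMap.id_apply, hTX z hz, smul_add]
  · exact isPolyConvex_image_id_add hX hT.continuous hη hη0 hST
      (fun w _ hr N => exists_closedBall_subset_ball w hr N) hsep
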